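/- arXiv:1503.06281 — 8 statements merged into one kernel-verified Lean document; each statement's English description precedes it below -/
import Mathlib

section
/- Let R and B be disjoint finite sets of points in the plane with |R| = n and |B| = n or |B| = n - 1, where n ≥ 1, and suppose some line contains at least |R ∪ B| - 2 points of P = R ∪ B. If P is neither collinear nor a near-pencil, then P determines at least |P| - 1 bichromatic lines. -/
open scoped Classical

noncomputable section

/-- A line in the plane: the affine span of two distinct points. -/
def IsLine (L : Set (ℝ × ℝ)) : Prop :=
  ∃ p q : ℝ × ℝ, p ≠ q ∧ L = (affineSpan ℝ ({p, q} : Set (ℝ × ℝ)) : Set (ℝ × ℝ))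

/-- The points of the finite set `P` lying on `L`. -/
def ptsOn (P : Finset (ℝ × ℝ)) (L : Set (ℝ × ℝ)) : Finset (ℝ × ℝ) :=
  P.filter (fun x => x ∈ L)

/-- A line determined by `P`: contains at least two points of `P`. -/
def DeterminedLine (P : Finset (ℝ × ℝ)) (L : Set (ℝ × ℝ)) : Prop :=
  IsLine L ∧ 2 ≤ (ptsOn P L).card

/-- A bichromatic line: determined by `R ∪ B`, with at least one red and one blue point. -/
def BichromaticLine (R B : Finset (ℝ × ℝ)) (L : Set (ℝ × ℝ)) : Prop :=
  DeterminedLine (R ∪ B) L ∧ (∃ p ∈ R, p ∈ L) ∧ (∃ p ∈ B, p ∈ L)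

/-- The number of bichromatic lines determined by `R ∪ B`. -/
def nBichromatic (R B : Finset (ℝ × ℝ)) : ℕ :=
  {L : Set (ℝ × ℝ) | BichromaticLine R B L}.ncard

/-- A near-pencil: some line contains all but exactly one of the points of `P`. -/
def NearPencil (P : Finset (ℝ × ℝ)) : Prop :=
  ∃ L : Set (ℝ × ℝ), IsLine L ∧ (ptsOn P L).card = P.card - 1

/-- The line through two points, as a set. -/
def lineThrough (p q : ℝ × ℝ) : Set (ℝ × ℝ) := (line[ℝ, p, q] : Set (ℝ × ℝ))

theorem left_mem_lineThrough (p q : ℝ × ℝ) : p ∈ lineThrough p q :=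
  left_mem_affineSpan_pair ℝ p q

theorem right_mem_lineThrough (p q : ℝ × ℝ) : q ∈ lineThrough p q :=
  right_mem_affineSpan_pair ℝ p q

theorem lineThrough_comm (p q : ℝ × ℝ) : lineThrough p q = lineThrough q p := by
  simp only [lineThrough, Set.pair_comm]

theorem isLine_lineThrough {p q : ℝ × ℝ} (h : p ≠ q) : IsLine (lineThrough p q) :=
  ⟨p, q, h, rfl⟩

theorem IsLine.eq_lineThrough {L : Set (ℝ × ℝ)} (hL : IsLine L) {p q : ℝ × ℝ} (hp : p ∈ L)
    (hq : q ∈ L) (hpq : p ≠ q) : L = lineThrough p q := by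
  obtain ⟨a, b, -, rfl⟩ := hL
  rw [lineThrough, affineSpan_pair_eq_of_mem_of_mem_of_ne hp hq hpq]

theorem IsLine.collinear {L : Set (ℝ × ℝ)} (hL : IsLine L) : Collinear ℝ L := by
  obtain ⟨a, b, -, rfl⟩ := hL
  rw [Collinear, ← direction_affineSpan, AffineSubspace.affineSpan_coe, direction_affineSpan]
  exact collinear_pair ℝ a b

/-- Lines joining points off `L` to points of `L` determine the points of `L` they pass through. -/
theorem IsLine.eq_of_lineThrough_eq {L : Set (ℝ × ℝ)} (hL : IsLine L) {p q x y : ℝ × ℝ}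
    (hp : p ∉ L) (hx : x ∈ L) (hy : y ∈ L) (h : lineThrough p x = lineThrough q y) : x = y := by
  by_contra hxy
  have hpx : p ≠ x := fun e => hp (e ▸ hx)
  have hy' : y ∈ lineThrough p x := h ▸ right_mem_lineThrough q y
  have hxL := (isLine_lineThrough hpx).eq_lineThrough (right_mem_lineThrough p x) hy' hxy
  rw [← hL.eq_lineThrough hx hy hxy] at hxL
  exact hp (hxL ▸ left_mem_lineThrough p x)

theorem IsLine.card_image_lineThrough {L : Set (ℝ × ℝ)} (hL : IsLine L) {p : ℝ × ℝ} (hp : p ∉ L)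
    {A : Finset (ℝ × ℝ)} (hA : ∀ x ∈ A, x ∈ L) : (A.image (lineThrough p)).card = A.card :=
  Finset.card_image_of_injOn fun x hx y hy h => hL.eq_of_lineThrough_eq hp (hA x hx) (hA y hy) h

theorem IsLine.disjoint_image_lineThrough {L : Set (ℝ × ℝ)} (hL : IsLine L) {p q : ℝ × ℝ}
    (hp : p ∉ L) {A C : Finset (ℝ × ℝ)} (hA : ∀ x ∈ A, x ∈ L) (hC : ∀ x ∈ C, x ∈ L)
    (hAC : Disjoint A C) : Disjoint (A.image (lineThrough p)) (C.image (lineThrough q)) := by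
  rw [Finset.disjoint_left]
  intro M hM hM'
  obtain ⟨x, hx, rfl⟩ := Finset.mem_image.1 hM
  obtain ⟨y, hy, hxy⟩ := Finset.mem_image.1 hM'
  have := hL.eq_of_lineThrough_eq hp (hA x hx) (hC y hy) hxy.symm
  subst this
  exact Finset.disjoint_left.1 hAC hx hy

theorem card_image_lineThrough_inter_le_one {p q : ℝ × ℝ} (hpq : p ≠ q) {A C : Finset (ℝ × ℝ)}
    (hp : p ∉ A) : (A.image (lineThrough p) ∩ C.image (lineThrough q)).card ≤ 1 := by
  suffices h : A.image (lineThrough p) ∩ C.image (lineThrough q) ⊆ {lineThrough p q} from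
    Finset.card_le_card h
  intro M hM
  obtain ⟨hM, hM'⟩ := Finset.mem_inter.1 hM
  obtain ⟨x, hx, rfl⟩ := Finset.mem_image.1 hM
  obtain ⟨y, hy, hxy⟩ := Finset.mem_image.1 hM'
  rw [Finset.mem_singleton]
  have hpx : p ≠ x := fun e => hp (e ▸ hx)
  exact (isLine_lineThrough hpx).eq_lineThrough (left_mem_lineThrough p x)
    (hxy ▸ left_mem_lineThrough q y) hpq

theorem bichromaticLine_iff {R B : Finset (ℝ × ℝ)} (hRB : Disjoint R B) {L : Set (ℝ × ℝ)} :
    BichromaticLine R B L ↔ ∃ r ∈ R, ∃ b ∈ B, lineThrough r b = L := by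
  constructor
  · rintro ⟨⟨hL, -⟩, ⟨r, hr, hrL⟩, b, hb, hbL⟩
    exact ⟨r, hr, b, hb, (hL.eq_lineThrough hrL hbL (Finset.disjoint_iff_ne.1 hRB r hr b hb)).symm⟩
  · rintro ⟨r, hr, b, hb, rfl⟩
    have hne := Finset.disjoint_iff_ne.1 hRB r hr b hb
    refine ⟨⟨isLine_lineThrough hne, Finset.one_lt_card.2 ⟨r, ?_, b, ?_, hne⟩⟩,
      ⟨r, hr, left_mem_lineThrough r b⟩, b, hb, right_mem_lineThrough r b⟩
    · simp [ptsOn, hr, left_mem_lineThrough]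
    · simp [ptsOn, hb, right_mem_lineThrough]

theorem nBichromatic_comm (R B : Finset (ℝ × ℝ)) : nBichromatic R B = nBichromatic B R := by
  simp only [nBichromatic, BichromaticLine, Finset.union_comm R B, and_comm]

theorem card_le_nBichromatic {R B : Finset (ℝ × ℝ)} (hRB : Disjoint R B)
    {S : Finset (Set (ℝ × ℝ))} (hS : ∀ L ∈ S, ∃ r ∈ R, ∃ b ∈ B, lineThrough r b = L) :
    S.card ≤ nBichromatic R B := by
  rw [nBichromatic, ← Set.ncard_coe_finset S]
  refine Set.ncard_le_ncard (fun L hL => (bichromaticLine_iff hRB).2 (hS L hL)) ?_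
  refine ((R ×ˢ B).image fun x => lineThrough x.1 x.2).finite_toSet.subset fun L hL => ?_
  obtain ⟨r, hr, b, hb, rfl⟩ := (bichromaticLine_iff hRB).1 hL
  exact Finset.mem_coe.2 (Finset.mem_image.2 ⟨(r, b), Finset.mem_product.2 ⟨hr, hb⟩, rfl⟩)

theorem notMem_union_image_lineThrough {L : Set (ℝ × ℝ)} {p q : ℝ × ℝ} (hp : p ∉ L)
    (hq : q ∉ L) (A C : Finset (ℝ × ℝ)) :
    L ∉ A.image (lineThrough p) ∪ C.image (lineThrough q) := by
  intro h
  rcases Finset.mem_union.1 h with h | h <;> obtain ⟨x, -, rfl⟩ := Finset.mem_image.1 h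
  · exact hp (left_mem_lineThrough p x)
  · exact hq (left_mem_lineThrough q x)

theorem card_sub_one_le_nBichromatic_of_opposite_colours {R B : Finset (ℝ × ℝ)}
    (hRB : Disjoint R B) (hR : 2 ≤ R.card) (hB : 2 ≤ B.card) {L : Set (ℝ × ℝ)} (hL : IsLine L)
    {p q : ℝ × ℝ} (hp : p ∈ R) (hq : q ∈ B) (hpL : p ∉ L) (hqL : q ∉ L)
    (hRL : ∀ x ∈ R.erase p, x ∈ L) (hBL : ∀ x ∈ B.erase q, x ∈ L) :
    R.card + B.card - 1 ≤ nBichromatic R B := by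
  have hcR := Finset.card_erase_of_mem hp
  have hcB := Finset.card_erase_of_mem hq
  have hd : Disjoint (B.erase q) (R.erase p) :=
    hRB.symm.mono (Finset.erase_subset q B) (Finset.erase_subset p R)
  have hS : (insert L ((B.erase q).image (lineThrough p) ∪
      (R.erase p).image (lineThrough q))).card = R.card + B.card - 1 := by
    rw [Finset.card_insert_of_notMem (notMem_union_image_lineThrough hpL hqL _ _),
      Finset.card_union_of_disjoint (hL.disjoint_image_lineThrough hpL hBL hRL hd),
      hL.card_image_lineThrough hpL hBL, hL.card_image_lineThrough hqL hRL]
    omega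
  rw [← hS]
  refine card_le_nBichromatic hRB fun M hM => ?_
  rcases Finset.mem_insert.1 hM with rfl | hM
  · obtain ⟨r, hr⟩ := Finset.card_pos.1 (show 0 < (R.erase p).card by omega)
    obtain ⟨b, hb⟩ := Finset.card_pos.1 (show 0 < (B.erase q).card by omega)
    have hr' := Finset.mem_of_mem_erase hr
    have hb' := Finset.mem_of_mem_erase hb
    exact ⟨r, hr', b, hb', (hL.eq_lineThrough (hRL r hr) (hBL b hb)
      (Finset.disjoint_iff_ne.1 hRB r hr' b hb')).symm⟩
  · rcases Finset.mem_union.1 hM with h | h <;> obtain ⟨x, hx, rfl⟩ := Finset.mem_image.1 h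
    · exact ⟨p, hp, x, Finset.mem_of_mem_erase hx, rfl⟩
    · exact ⟨x, Finset.mem_of_mem_erase hx, q, hq, lineThrough_comm x q⟩

theorem card_sub_one_le_nBichromatic_of_same_colour {R B : Finset (ℝ × ℝ)}
    (hRB : Disjoint R B) (hle : R.card ≤ B.card + 1) (hB : 2 ≤ B.card)
    {L : Set (ℝ × ℝ)} (hL : IsLine L) {p q : ℝ × ℝ} (hp : p ∈ R) (hq : q ∈ R) (hpq : p ≠ q)
    (hpL : p ∉ L) (hqL : q ∉ L) (hRL : ∀ x ∈ (R.erase p).erase q, x ∈ L) (hBL : ∀ x ∈ B, x ∈ L) :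
    R.card + B.card - 1 ≤ nBichromatic R B := by
  set S := B.image (lineThrough p) ∪ B.image (lineThrough q) with hSdef
  have hS : 2 * B.card - 1 ≤ S.card := by
    have h := Finset.card_union_add_card_inter (B.image (lineThrough p)) (B.image (lineThrough q))
    have hi := card_image_lineThrough_inter_le_one (C := B) hpq fun h => hpL (hBL p h)
    rw [hL.card_image_lineThrough hpL hBL, hL.card_image_lineThrough hqL hBL, ← hSdef] at h
    omega
  have hSb : ∀ M ∈ S, ∃ r ∈ R, ∃ b ∈ B, lineThrough r b = M := by
    intro M hM
    rcases Finset.mem_union.1 hM with h | h <;> obtain ⟨x, hx, rfl⟩ := Finset.mem_image.1 h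
    · exact ⟨p, hp, x, hx, rfl⟩
    · exact ⟨q, hq, x, hx, rfl⟩
  rcases ((R.erase p).erase q).eq_empty_or_nonempty with he | ⟨r, hr⟩
  · have hc := Finset.card_erase_of_mem (Finset.mem_erase.2 ⟨hpq.symm, hq⟩)
    rw [he, Finset.card_erase_of_mem hp, Finset.card_empty] at hc
    have := card_le_nBichromatic hRB hSb
    omega
  · have hins : ∀ M ∈ insert L S, ∃ r ∈ R, ∃ b ∈ B, lineThrough r b = M := by
      intro M hM
      rcases Finset.mem_insert.1 hM with rfl | hM
      · obtain ⟨b, hb⟩ := Finset.card_pos.1 (show 0 < B.card by omega)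
        have hr' := Finset.mem_of_mem_erase (Finset.mem_of_mem_erase hr)
        exact ⟨r, hr', b, hb, (hL.eq_lineThrough (hRL r hr) (hBL b hb)
          (Finset.disjoint_iff_ne.1 hRB r hr' b hb)).symm⟩
      · exact hSb M hM
    have := card_le_nBichromatic hRB hins
    have hLS : L ∉ S := notMem_union_image_lineThrough hpL hqL B B
    rw [Finset.card_insert_of_notMem hLS] at this
    omega

theorem card_ptsOn_lt_of_not_collinear {P : Finset (ℝ × ℝ)}
    (hP : ¬ Collinear ℝ (P : Set (ℝ × ℝ))) {L : Set (ℝ × ℝ)} (hL : IsLine L) :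
    (ptsOn P L).card < P.card := by
  refine Finset.card_lt_card (Finset.filter_ssubset.2 ?_)
  by_contra! h
  exact hP (hL.collinear.subset fun x hx => h x hx)

theorem four_le_card_of_not_nearPencil {P : Finset (ℝ × ℝ)}
    (hP : ¬ Collinear ℝ (P : Set (ℝ × ℝ))) (hnp : ¬ NearPencil P) : 4 ≤ P.card := by
  obtain ⟨a, ha, b, hb, hab⟩ : ∃ a ∈ P, ∃ b ∈ P, a ≠ b := by
    by_contra! h
    rcases Set.Subsingleton.eq_empty_or_singleton (s := (P : Set (ℝ × ℝ)))
      (fun x hx y hy => h x hx y hy) with e | ⟨x, e⟩ <;> rw [e] at hP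
    · exact hP (collinear_empty ℝ _)
    · exact hP (collinear_singleton ℝ x)
  have hlt := card_ptsOn_lt_of_not_collinear hP (isLine_lineThrough hab)
  have h2 : 1 < (ptsOn P (lineThrough a b)).card :=
    Finset.one_lt_card.2 ⟨a, by simp [ptsOn, ha, left_mem_lineThrough], b,
      by simp [ptsOn, hb, right_mem_lineThrough], hab⟩
  have hne : (ptsOn P (lineThrough a b)).card ≠ P.card - 1 :=
    fun h => hnp ⟨_, isLine_lineThrough hab, h⟩
  omega

/-- **Corollary 2.3.** There is no counterexample to the main theorem with
`|P| - 2` collinear points: if some line contains at least `|R ∪ B| - 2` points of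
`P = R ∪ B` and `P` is neither collinear nor a near-pencil, then there are at least
`|P| - 1` bichromatic lines. -/
theorem bichromatic_lines_of_card_sub_two_collinear
    (n : ℕ) (hn : 1 ≤ n) (R B : Finset (ℝ × ℝ)) (hRB : Disjoint R B)
    (hR : R.card = n) (hB : B.card = n ∨ B.card = n - 1)
    (hbig : ∃ L : Set (ℝ × ℝ), IsLine L ∧
      (R ∪ B).card - 2 ≤ (ptsOn (R ∪ B) L).card)
    (hcol : ¬ Collinear ℝ ((R ∪ B : Finset (ℝ × ℝ)) : Set (ℝ × ℝ)))
    (hnp : ¬ NearPencil (R ∪ B)) :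
    (R ∪ B).card - 1 ≤ nBichromatic R B := by
  obtain ⟨L, hL, hbig⟩ := hbig
  have h4 := four_le_card_of_not_nearPencil hcol hnp
  have hlt := card_ptsOn_lt_of_not_collinear hcol hL
  have hne : (ptsOn (R ∪ B) L).card ≠ (R ∪ B).card - 1 := fun h => hnp ⟨L, hL, h⟩
  have hadd := Finset.card_filter_add_card_filter_not (s := R ∪ B) (fun x => x ∈ L)
  have htwo : ((R ∪ B).filter fun x => x ∉ L).card = 2 := by
    simp only [ptsOn] at hbig hlt hne
    omega
  obtain ⟨p, q, hpq, hoff⟩ := Finset.card_eq_two.1 htwo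
  have hmem : ∀ x, (x ∈ R ∨ x ∈ B) ∧ x ∉ L ↔ x = p ∨ x = q := fun x => by
    simpa using Finset.ext_iff.1 hoff x
  obtain ⟨hp, hpL⟩ := (hmem p).2 (Or.inl rfl)
  obtain ⟨hq, hqL⟩ := (hmem q).2 (Or.inr rfl)
  have hd := Finset.disjoint_left.1 hRB
  rw [Finset.card_union_of_disjoint hRB] at h4 ⊢
  rcases hp with hp | hp <;> rcases hq with hq | hq
  · exact card_sub_one_le_nBichromatic_of_same_colour hRB (by omega) (by omega) hL hp hq hpq
      hpL hqL (by grind) (by grind)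
  · exact card_sub_one_le_nBichromatic_of_opposite_colours hRB (by omega) (by omega) hL hp hq
      hpL hqL (by grind) (by grind)
  · exact card_sub_one_le_nBichromatic_of_opposite_colours hRB (by omega) (by omega) hL hq hp
      hqL hpL (by grind) (by grind)
  · rw [nBichromatic_comm, Nat.add_comm]
    exact card_sub_one_le_nBichromatic_of_same_colour hRB.symm (by omega) (by omega) hL hp hq hpq
      hpL hqL (by grind) (by grind)
end
end

section
/- Let R and B be disjoint finite sets of points in the plane, and let L be a line containing exactly r ≥ 1 points of R and exactly b ≥ 1 points of B. Set r' = |R \ L| and b' = |B \ L|, and assume r' ≥ 1 and b' ≥ 1. Then R ∪ B determines at least 1 + min over i ∈ {1, …, b'} of ( i + (r - 1)·max{⌈b'/i⌉, i} ) + min over i ∈ {1, …, r'} of ( i + (b - 1)·max{⌈r'/i⌉, i} ) bichromatic lines. -/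
open scoped Classical

noncomputable section

/-- A line is the affine span of any two of its points. -/
theorem IsLine.eq_affineSpan_pair {L : Set (ℝ × ℝ)} (hL : IsLine L) {p q : ℝ × ℝ}
    (hp : p ∈ L) (hq : q ∈ L) (hpq : p ≠ q) :
    L = (affineSpan ℝ ({p, q} : Set (ℝ × ℝ)) : Set (ℝ × ℝ)) := by
  obtain ⟨u, v, -, rfl⟩ := hL
  have hle := affineSpan_pair_le_of_mem_of_mem hp hq
  obtain ⟨s, rfl⟩ := mem_affineSpan_pair_iff_exists_lineMap_eq.1 hp
  obtain ⟨t, rfl⟩ := mem_affineSpan_pair_iff_exists_lineMap_eq.1 hq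
  have hst : t - s ≠ 0 := fun h => hpq (by rw [sub_eq_zero.1 h])
  refine congrArg _ (le_antisymm (affineSpan_pair_le_of_mem_of_mem ?_ ?_) hle)
  · refine mem_affineSpan_pair_iff_exists_lineMap_eq.2 ⟨-s / (t - s), ?_⟩
    ext <;> simp [AffineMap.lineMap_apply] <;> field_simp <;> ring
  · refine mem_affineSpan_pair_iff_exists_lineMap_eq.2 ⟨(1 - s) / (t - s), ?_⟩
    ext <;> simp [AffineMap.lineMap_apply] <;> field_simp <;> ring

/-- Two lines sharing two distinct points coincide. -/
theorem IsLine.eq_of_mem {L M : Set (ℝ × ℝ)} (hL : IsLine L) (hM : IsLine M) {p q : ℝ × ℝ}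
    (hpq : p ≠ q) (hpL : p ∈ L) (hqL : q ∈ L) (hpM : p ∈ M) (hqM : q ∈ M) : L = M :=
  (hL.eq_affineSpan_pair hpL hqL hpq).trans (hM.eq_affineSpan_pair hpM hqM hpq).symm

/-- The lines joining `p` to the points of `Q`. -/
def linesThrough (Q : Finset (ℝ × ℝ)) (p : ℝ × ℝ) : Finset (Set (ℝ × ℝ)) :=
  Q.image fun q => (affineSpan ℝ ({p, q} : Set (ℝ × ℝ)) : Set (ℝ × ℝ))

theorem exists_of_mem_linesThrough {Q : Finset (ℝ × ℝ)} {p : ℝ × ℝ} {M : Set (ℝ × ℝ)}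
    (hp : p ∉ Q) (hM : M ∈ linesThrough Q p) : IsLine M ∧ p ∈ M ∧ ∃ q ∈ Q, q ∈ M := by
  obtain ⟨q, hq, rfl⟩ := Finset.mem_image.1 hM
  exact ⟨⟨p, q, fun h => hp (h ▸ hq), rfl⟩, left_mem_affineSpan_pair ℝ p q, q, hq,
    right_mem_affineSpan_pair ℝ p q⟩

theorem card_le_card_linesThrough_mul {L : Set (ℝ × ℝ)} (hL : IsLine L) {Q : Finset (ℝ × ℝ)}
    (hQ : ∀ q ∈ Q, q ∉ L) {p p' : ℝ × ℝ} (hp : p ∈ L) (hp' : p' ∈ L) (hpp' : p ≠ p') :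
    Q.card ≤ (linesThrough Q p).card * (linesThrough Q p').card := by
  rw [← Finset.card_product]
  refine Finset.card_le_card_of_injOn
    (fun q => ((affineSpan ℝ ({p, q} : Set (ℝ × ℝ)) : Set (ℝ × ℝ)),
      (affineSpan ℝ ({p', q} : Set (ℝ × ℝ)) : Set (ℝ × ℝ)))) ?_ ?_
  · intro q hq
    exact Finset.mem_product.2 ⟨Finset.mem_image_of_mem _ hq, Finset.mem_image_of_mem _ hq⟩
  · intro q hq q' hq' h
    by_contra hne
    obtain ⟨h1, h2⟩ := Prod.mk.inj h
    have key : ∀ x ∈ L, IsLine (affineSpan ℝ ({x, q} : Set (ℝ × ℝ)) : Set (ℝ × ℝ)) :=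
      fun x hx => ⟨x, q, fun h => hQ q hq (h ▸ hx), rfl⟩
    have hmem := right_mem_affineSpan_pair ℝ p q
    have hEq := (key p hp).eq_of_mem (key p' hp') hne hmem
      (h1 ▸ right_mem_affineSpan_pair ℝ p q') (right_mem_affineSpan_pair ℝ p' q)
      (h2 ▸ right_mem_affineSpan_pair ℝ p' q')
    have hLEq := hL.eq_of_mem (key p hp) hpp' hp hp' (left_mem_affineSpan_pair ℝ p q)
      (hEq ▸ left_mem_affineSpan_pair ℝ p' q)
    exact hQ q hq (hLEq ▸ hmem)

theorem card_biUnion_linesThrough {L : Set (ℝ × ℝ)} (hL : IsLine L) {S Q : Finset (ℝ × ℝ)}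
    (hS : ∀ p ∈ S, p ∈ L) (hQ : ∀ q ∈ Q, q ∉ L) :
    (S.biUnion (linesThrough Q)).card = ∑ p ∈ S, (linesThrough Q p).card := by
  refine Finset.card_biUnion fun p hp p' hp' hne => Finset.disjoint_left.2 fun M hM hM' => ?_
  obtain ⟨hM1, hpM, q, hq, hqM⟩ := exists_of_mem_linesThrough (fun h => hQ p h (hS p hp)) hM
  obtain ⟨-, hpM', -⟩ := exists_of_mem_linesThrough (fun h => hQ p' h (hS p' hp')) hM'
  exact hQ q hq (hL.eq_of_mem hM1 hne (hS p hp) (hS p' hp') hpM hpM' ▸ hqM)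

/-- If the pairwise products of positive integers `d p ≤ m` are at least `m`, their sum is bounded
below in terms of the smallest of them. -/
theorem inf'_le_sum_of_le_mul {α : Type*} {S : Finset α} (hS : S.Nonempty) {m : ℕ}
    (hm : 1 ≤ m) (d : α → ℕ) (h1 : ∀ p ∈ S, 1 ≤ d p) (h2 : ∀ p ∈ S, d p ≤ m)
    (h : ∀ p ∈ S, ∀ p' ∈ S, p ≠ p' → m ≤ d p * d p') :
    (Finset.Icc 1 m).inf' (Finset.nonempty_Icc.mpr hm)
      (fun i => i + (S.card - 1) * max ((m + i - 1) / i) i) ≤ ∑ p ∈ S, d p := by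
  obtain ⟨p, hp, hmin⟩ := S.exists_min_image d hS
  refine (Finset.inf'_le _ (Finset.mem_Icc.2 ⟨h1 p hp, h2 p hp⟩)).trans ?_
  rw [← Finset.add_sum_erase S d hp, ← Finset.card_erase_of_mem hp, ← smul_eq_mul (Finset.card _)]
  refine Nat.add_le_add_left (Finset.card_nsmul_le_sum _ _ _ fun p' hp' => ?_) _
  obtain ⟨hne, hpS'⟩ := Finset.mem_erase.1 hp'
  refine max_le ?_ (hmin p' hpS')
  have hmul := h p hp p' hpS' hne.symm
  have hpos := h1 p hp
  rw [← Nat.lt_succ_iff, Nat.div_lt_iff_lt_mul hpos, Nat.succ_mul, mul_comm]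
  omega

theorem inf'_le_card_biUnion_linesThrough {L : Set (ℝ × ℝ)} (hL : IsLine L)
    {S Q : Finset (ℝ × ℝ)} (hS : ∀ p ∈ S, p ∈ L) (hQ : ∀ q ∈ Q, q ∉ L) (hS1 : S.Nonempty)
    (hQ1 : 1 ≤ Q.card) :
    (Finset.Icc 1 Q.card).inf' (Finset.nonempty_Icc.mpr hQ1)
      (fun i => i + (S.card - 1) * max ((Q.card + i - 1) / i) i) ≤
      (S.biUnion (linesThrough Q)).card := by
  rw [card_biUnion_linesThrough hL hS hQ]
  exact inf'_le_sum_of_le_mul hS1 hQ1 _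
    (fun p _ => Finset.card_pos.2 ((Finset.card_pos.1 hQ1).image _))
    (fun p _ => Finset.card_image_le)
    (fun p hp p' hp' => card_le_card_linesThrough_mul hL hQ (hS p hp) (hS p' hp'))

theorem bichromaticLine_of_mem {R B : Finset (ℝ × ℝ)} (hRB : Disjoint R B) {L : Set (ℝ × ℝ)}
    (hL : IsLine L) {p q : ℝ × ℝ} (hp : p ∈ R) (hq : q ∈ B) (hpL : p ∈ L) (hqL : q ∈ L) :
    BichromaticLine R B L := by
  refine ⟨⟨hL, Finset.one_lt_card.2 ⟨p, ?_, q, ?_, fun h => ?_⟩⟩, ⟨p, hp, hpL⟩, q, hq, hqL⟩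
  · simp [ptsOn, hp, hpL]
  · simp [ptsOn, hq, hqL]
  · exact Finset.disjoint_left.1 hRB hp (h ▸ hq)

theorem finite_bichromaticLine {R B : Finset (ℝ × ℝ)} (hRB : Disjoint R B) :
    {L : Set (ℝ × ℝ) | BichromaticLine R B L}.Finite := by
  refine (R.biUnion (linesThrough B)).finite_toSet.subset ?_
  rintro M ⟨⟨hM, -⟩, ⟨p, hp, hpM⟩, q, hq, hqM⟩
  have hpq : p ≠ q := fun h => Finset.disjoint_left.1 hRB hp (h ▸ hq)
  exact Finset.mem_biUnion.2
    ⟨p, hp, Finset.mem_image.2 ⟨q, hq, (hM.eq_affineSpan_pair hpM hqM hpq).symm⟩⟩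

/-- **Lemma 4.3.** If a bichromatic line `L` contains `r ≥ 1` red and `b ≥ 1` blue
points, and `r' = |R \ L| ≥ 1`, `b' = |B \ L| ≥ 1`, then the number of bichromatic
lines is at least
`1 + min_{i ∈ [b']} (i + (r-1)·max{⌈b'/i⌉, i}) + min_{i ∈ [r']} (i + (b-1)·max{⌈r'/i⌉, i})`.
(Here `⌈m/i⌉ = (m + i - 1)/i` for `i ≥ 1` in natural-number arithmetic.) -/
theorem bichromatic_count_tricky
    (R B : Finset (ℝ × ℝ)) (hRB : Disjoint R B)
    (L : Set (ℝ × ℝ)) (hL : IsLine L) (r b r' b' : ℕ)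
    (hr : (ptsOn R L).card = r) (hb : (ptsOn B L).card = b)
    (hr1 : 1 ≤ r) (hb1 : 1 ≤ b)
    (hr' : (R.filter (fun x => x ∉ L)).card = r')
    (hb' : (B.filter (fun x => x ∉ L)).card = b')
    (hr'1 : 1 ≤ r') (hb'1 : 1 ≤ b') :
    1 + (Finset.Icc 1 b').inf' (Finset.nonempty_Icc.mpr hb'1)
          (fun i => i + (r - 1) * max ((b' + i - 1) / i) i)
      + (Finset.Icc 1 r').inf' (Finset.nonempty_Icc.mpr hr'1)
          (fun i => i + (b - 1) * max ((r' + i - 1) / i) i)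
      ≤ nBichromatic R B := by
  subst hr hb hr' hb'
  have hSR : ∀ p ∈ ptsOn R L, p ∈ R ∧ p ∈ L := fun p hp => Finset.mem_filter.1 hp
  have hSB : ∀ p ∈ ptsOn B L, p ∈ B ∧ p ∈ L := fun p hp => Finset.mem_filter.1 hp
  set QR := R.filter (fun x => x ∉ L) with hQR
  set QB := B.filter (fun x => x ∉ L) with hQB
  have hQR' : ∀ q ∈ QR, q ∈ R ∧ q ∉ L := fun q hq => Finset.mem_filter.1 hq
  have hQB' : ∀ q ∈ QB, q ∈ B ∧ q ∉ L := fun q hq => Finset.mem_filter.1 hq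
  have hneR := Finset.card_pos.1 hr1
  have hneB := Finset.card_pos.1 hb1
  have hcardR := inf'_le_card_biUnion_linesThrough hL (fun p hp => (hSR p hp).2)
    (fun q hq => (hQB' q hq).2) hneR hb'1
  have hcardB := inf'_le_card_biUnion_linesThrough hL (fun p hp => (hSB p hp).2)
    (fun q hq => (hQR' q hq).2) hneB hr'1
  have hUR : ∀ M ∈ (ptsOn R L).biUnion (linesThrough QB),
      IsLine M ∧ (∃ p ∈ R, p ∈ L ∧ p ∈ M) ∧ ∃ q ∈ B, q ∉ L ∧ q ∈ M := by
    intro M hM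
    obtain ⟨p, hp, hM⟩ := Finset.mem_biUnion.1 hM
    obtain ⟨hM, hpM, q, hq, hqM⟩ :=
      exists_of_mem_linesThrough (fun h => (hQB' p h).2 (hSR p hp).2) hM
    exact ⟨hM, ⟨p, (hSR p hp).1, (hSR p hp).2, hpM⟩, q, (hQB' q hq).1, (hQB' q hq).2, hqM⟩
  have hUB : ∀ M ∈ (ptsOn B L).biUnion (linesThrough QR),
      IsLine M ∧ (∃ p ∈ B, p ∈ L ∧ p ∈ M) ∧ ∃ q ∈ R, q ∉ L ∧ q ∈ M := by
    intro M hM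
    obtain ⟨p, hp, hM⟩ := Finset.mem_biUnion.1 hM
    obtain ⟨hM, hpM, q, hq, hqM⟩ :=
      exists_of_mem_linesThrough (fun h => (hQR' p h).2 (hSB p hp).2) hM
    exact ⟨hM, ⟨p, (hSB p hp).1, (hSB p hp).2, hpM⟩, q, (hQR' q hq).1, (hQR' q hq).2, hqM⟩
  set UR := (ptsOn R L).biUnion (linesThrough QB)
  set UB := (ptsOn B L).biUnion (linesThrough QR)
  have hdisj : Disjoint UR UB := by
    refine Finset.disjoint_left.2 fun M hM hM' => ?_
    obtain ⟨hM1, ⟨p, hp, hpL, hpM⟩, q, -, hqL, hqM⟩ := hUR M hM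
    obtain ⟨-, ⟨p', hp', hpL', hpM'⟩, -⟩ := hUB M hM'
    have hne : p ≠ p' := fun h => Finset.disjoint_left.1 hRB hp (h ▸ hp')
    exact hqL (hL.eq_of_mem hM1 hne hpL hpL' hpM hpM' ▸ hqM)
  have hnotMem : L ∉ UR ∪ UB := by
    intro h
    rcases Finset.mem_union.1 h with h | h
    · obtain ⟨-, -, q, -, hqL, hqM⟩ := hUR L h
      exact hqL hqM
    · obtain ⟨-, -, q, -, hqL, hqM⟩ := hUB L h
      exact hqL hqM
  have hsub : ((insert L (UR ∪ UB) : Finset (Set (ℝ × ℝ))) : Set (Set (ℝ × ℝ))) ⊆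
      {L : Set (ℝ × ℝ) | BichromaticLine R B L} := by
    intro M hM
    rcases Finset.mem_insert.1 (Finset.mem_coe.1 hM) with rfl | hM
    · obtain ⟨p, hp⟩ := hneR
      obtain ⟨q, hq⟩ := hneB
      exact bichromaticLine_of_mem hRB hL (hSR p hp).1 (hSB q hq).1 (hSR p hp).2 (hSB q hq).2
    rcases Finset.mem_union.1 hM with hM | hM
    · obtain ⟨hM1, ⟨p, hp, -, hpM⟩, q, hq, -, hqM⟩ := hUR M hM
      exact bichromaticLine_of_mem hRB hM1 hp hq hpM hqM
    · obtain ⟨hM1, ⟨p, hp, -, hpM⟩, q, hq, -, hqM⟩ := hUB M hM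
      exact bichromaticLine_of_mem hRB hM1 hq hp hqM hpM
  have hcard := Set.ncard_le_ncard hsub (finite_bichromaticLine hRB)
  rw [Set.ncard_coe_finset, Finset.card_insert_of_notMem hnotMem,
    Finset.card_union_of_disjoint hdisj] at hcard
  refine (Nat.add_le_add (Nat.add_le_add le_rfl hcardR) hcardB).trans ?_
  unfold nBichromatic
  omega
end
end

section
/- Let S be a finite set of cardinality n ≥ 2 and let S₁, …, S_k be pairwise distinct subsets of S such that every pair of distinct elements of S is contained in exactly one Sᵢ. Then either S = Sᵢ for some i, or k ≥ n. -/
/-- **de Bruijn–Erdős theorem (combinatorial form).** If `S` has `n ≥ 2` elements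
and `S₁, …, S_k` are pairwise distinct subsets of `S` such that every pair of
distinct elements of `S` lies in exactly one `Sᵢ`, then either some `Sᵢ = S`
or `k ≥ n`. -/
theorem deBruijn_erdos {α : Type*} [DecidableEq α]
    (S : Finset α) (n : ℕ) (hS : S.card = n) (hn : 2 ≤ n)
    (k : ℕ) (F : Fin k → Finset α)
    (hsub : ∀ i, F i ⊆ S)
    (hdist : Function.Injective F)
    (hcover : ∀ x ∈ S, ∀ y ∈ S, x ≠ y → ∃! i, x ∈ F i ∧ y ∈ F i) :
    (∃ i, F i = S) ∨ n ≤ k := by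
  by_cases h : ∃ i, F i = S
  · exact Or.inl h
  right
  have exists_point (i : Fin k) : ∃ p : S, p.1 ∉ F i := by
    by_contra! hi
    exact h ⟨i, (hsub i).antisymm fun x hx => hi ⟨x, hx⟩⟩
  have exists_index {p q : S} (hpq : p ≠ q) : ∃ i, p.1 ∈ F i ∧ q.1 ∈ F i :=
    (hcover p p.2 q q.2 (Subtype.coe_ne_coe.mpr hpq)).exists
  have eq_or_eq {p q : S} {i j : Fin k} (hpi : p.1 ∈ F i) (hqi : q.1 ∈ F i)
      (hpj : p.1 ∈ F j) (hqj : q.1 ∈ F j) : p = q ∨ i = j := by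
    by_cases hpq : p = q
    · exact Or.inl hpq
    · exact Or.inr ((hcover p p.2 q q.2 (Subtype.coe_ne_coe.mpr hpq)).unique
        ⟨hpi, hqi⟩ ⟨hpj, hqj⟩)
  have exists_line (p : S) : ∃ i, p.1 ∉ F i := by
    by_contra! hp
    have : Nontrivial S := Fintype.one_lt_card_iff_nontrivial.mp (by simp; omega)
    obtain ⟨q, hqp⟩ := exists_ne p
    obtain ⟨i, -, hqi⟩ := exists_index hqp.symm
    obtain ⟨r, hri⟩ := exists_point i
    have hqr : q ≠ r := by
      rintro rfl
      exact hri hqi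
    obtain ⟨j, hqj, hrj⟩ := exists_index hqr
    obtain hpq | rfl := eq_or_eq (hp i) hqi (hp j) hqj
    · exact hqp hpq.symm
    · exact hri hrj
  let _ : Membership S (Fin k) := ⟨fun i p => p.1 ∈ F i⟩
  let _ : Configuration.HasLines S (Fin k) :=
    { exists_point := exists_point
      exists_line := exists_line
      eq_or_eq := eq_or_eq
      mkLine := fun hpq => (exists_index hpq).choose
      mkLine_ax := fun hpq => (exists_index hpq).choose_spec }
  simpa [hS] using Configuration.HasLines.card_le S (Fin k)
end

section
/- Every finite non-collinear set of n points in the plane determines at least n lines. -/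
open scoped Classical

noncomputable section

theorem determinedLine_affineSpan_pair {P : Finset (ℝ × ℝ)} {p q : ℝ × ℝ}
    (hp : p ∈ P) (hq : q ∈ P) (hpq : p ≠ q) :
    DeterminedLine P (affineSpan ℝ ({p, q} : Set (ℝ × ℝ)) : Set (ℝ × ℝ)) := by
  refine ⟨⟨p, q, hpq, rfl⟩, Finset.one_lt_card.mpr ⟨p, ?_, q, ?_, hpq⟩⟩
  · exact Finset.mem_filter.mpr ⟨hp, left_mem_affineSpan_pair ℝ p q⟩
  · exact Finset.mem_filter.mpr ⟨hq, right_mem_affineSpan_pair ℝ p q⟩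

theorem finite_setOf_determinedLine (P : Finset (ℝ × ℝ)) :
    {L : Set (ℝ × ℝ) | DeterminedLine P L}.Finite := by
  refine ((P ×ˢ P).finite_toSet.image fun x : (ℝ × ℝ) × (ℝ × ℝ) =>
    (affineSpan ℝ ({x.1, x.2} : Set (ℝ × ℝ)) : Set (ℝ × ℝ))).subset ?_
  rintro L ⟨hL, hcard⟩
  obtain ⟨p, hp, q, hq, hpq⟩ := Finset.one_lt_card.mp hcard
  obtain ⟨hpP, hpL⟩ := Finset.mem_filter.mp hp
  obtain ⟨hqP, hqL⟩ := Finset.mem_filter.mp hq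
  exact ⟨(p, q), Finset.mem_coe.mpr (Finset.mem_product.mpr ⟨hpP, hqP⟩),
    (hL.eq_affineSpan_pair hpL hqL hpq).symm⟩

theorem IsLine.exists_notMem {P : Finset (ℝ × ℝ)} (hP : ¬ Collinear ℝ (P : Set (ℝ × ℝ)))
    {L : Set (ℝ × ℝ)} (hL : IsLine L) : ∃ p ∈ P, p ∉ L := by
  by_contra! h
  exact hP (hL.collinear.subset h)

theorem exists_determinedLine_notMem {P : Finset (ℝ × ℝ)}
    (hP : ¬ Collinear ℝ (P : Set (ℝ × ℝ))) (p : ℝ × ℝ) :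
    ∃ L, DeterminedLine P L ∧ p ∉ L := by
  obtain ⟨q, hq, hqp⟩ : ∃ q ∈ P, q ≠ p := by
    by_contra! h
    exact hP ((collinear_singleton ℝ p).subset h)
  obtain ⟨r, hr, hrL⟩ := IsLine.exists_notMem hP ⟨p, q, hqp.symm, rfl⟩
  have hqr : q ≠ r := by
    rintro rfl
    exact hrL (right_mem_affineSpan_pair ℝ p q)
  have hdet := determinedLine_affineSpan_pair hq hr hqr
  refine ⟨_, hdet, fun hmem => hrL ?_⟩
  rw [← hdet.1.eq_affineSpan_pair hmem (left_mem_affineSpan_pair ℝ q r) hqp.symm]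
  exact right_mem_affineSpan_pair ℝ q r

/-- Incidence between the points of `P` and the lines they determine. -/
instance determinedLineMembership (P : Finset (ℝ × ℝ)) :
    Membership {p // p ∈ P} {L // DeterminedLine P L} :=
  ⟨fun L p => p.1 ∈ L.1⟩

/-- The configuration of the points of a non-collinear set and the lines they determine. -/
@[reducible] def determinedLineHasLines {P : Finset (ℝ × ℝ)}
    (hP : ¬ Collinear ℝ (P : Set (ℝ × ℝ))) :
    Configuration.HasLines {p // p ∈ P} {L // DeterminedLine P L} where
  exists_point L :=
    let ⟨p, hp, hpL⟩ := L.2.1.exists_notMem hP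
    ⟨⟨p, hp⟩, hpL⟩
  exists_line p :=
    let ⟨L, hL, hpL⟩ := exists_determinedLine_notMem hP p.1
    ⟨⟨L, hL⟩, hpL⟩
  eq_or_eq {p q L M} hpL hqL hpM hqM := by
    refine or_iff_not_imp_left.mpr fun hpq => Subtype.ext ?_
    have hne : p.1 ≠ q.1 := fun h => hpq (Subtype.ext h)
    rw [L.2.1.eq_affineSpan_pair hpL hqL hne, M.2.1.eq_affineSpan_pair hpM hqM hne]
  mkLine {p q} h :=
    ⟨_, determinedLine_affineSpan_pair p.2 q.2 fun h' => h (Subtype.ext h')⟩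
  mkLine_ax {p q} _ :=
    ⟨left_mem_affineSpan_pair ℝ p.1 q.1, right_mem_affineSpan_pair ℝ p.1 q.1⟩

/-- **de Bruijn–Erdős theorem (plane case).** Every finite non-collinear set of `n`
points in the plane determines at least `n` lines. -/
theorem deBruijn_erdos_plane
    (P : Finset (ℝ × ℝ)) (hP : ¬ Collinear ℝ (P : Set (ℝ × ℝ))) :
    P.card ≤ {L : Set (ℝ × ℝ) | DeterminedLine P L}.ncard := by
  let := determinedLineHasLines hP
  let : Fintype {L // DeterminedLine P L} := (finite_setOf_determinedLine P).fintype
  have h := Configuration.HasLines.card_le {p // p ∈ P} {L // DeterminedLine P L}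
  rwa [Fintype.card_coe, ← Nat.card_eq_fintype_card (α := {L // DeterminedLine P L})] at h
end
end

section
/- Every finite non-collinear set of points in the plane determines a line containing exactly two points of the set (Sylvester–Gallai theorem). -/
open scoped Classical

noncomputable section

/-- Twice the signed area of the triangle `a b c`. -/
def signedArea (a b c : ℝ × ℝ) : ℝ :=
  (b.1 - a.1) * (c.2 - a.2) - (b.2 - a.2) * (c.1 - a.1)

/-- The square of the Euclidean distance between `a` and `b`. -/
def sqDist (a b : ℝ × ℝ) : ℝ :=
  (b.1 - a.1) ^ 2 + (b.2 - a.2) ^ 2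

lemma sqDist_pos {a b : ℝ × ℝ} (h : a ≠ b) : 0 < sqDist a b := by
  unfold sqDist
  by_contra! h0
  apply h
  ext <;> nlinarith [sq_nonneg (b.1 - a.1), sq_nonneg (b.2 - a.2)]

lemma ne_of_signedArea_ne_zero {a b c : ℝ × ℝ} (h : signedArea a b c ≠ 0) : a ≠ b := by
  rintro rfl
  simp [signedArea] at h

lemma exists_lineMap_eq_of_signedArea_eq_zero {a b c : ℝ × ℝ} (hab : a ≠ b)
    (h : signedArea a b c = 0) : ∃ t : ℝ, AffineMap.lineMap a b t = c := by
  have hpos := sqDist_pos hab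
  refine ⟨((c.1 - a.1) * (b.1 - a.1) + (c.2 - a.2) * (b.2 - a.2)) / sqDist a b, ?_⟩
  unfold signedArea at h
  ext
  · simp only [AffineMap.lineMap_apply, vsub_eq_sub, vadd_eq_add, Prod.fst_add, Prod.smul_fst,
      Prod.fst_sub, smul_eq_mul]
    field_simp
    unfold sqDist
    linear_combination (b.2 - a.2) * h
  · simp only [AffineMap.lineMap_apply, vsub_eq_sub, vadd_eq_add, Prod.snd_add, Prod.smul_snd,
      Prod.snd_sub, smul_eq_mul]
    field_simp
    unfold sqDist
    linear_combination -(b.1 - a.1) * h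

lemma exists_signedArea_ne_zero {s : Set (ℝ × ℝ)} (hs : ¬ Collinear ℝ s) :
    ∃ a ∈ s, ∃ b ∈ s, ∃ c ∈ s, signedArea a b c ≠ 0 := by
  by_contra! h
  apply hs
  rcases s.subsingleton_or_nontrivial with hsub | ⟨a, ha, b, hb, hab⟩
  · obtain rfl | ⟨a, rfl⟩ := Set.Subsingleton.eq_empty_or_singleton hsub
    · exact collinear_empty ℝ _
    · exact collinear_singleton ℝ a
  · rw [collinear_iff_of_mem ha]
    refine ⟨b - a, fun c hc => ?_⟩
    obtain ⟨t, rfl⟩ := exists_lineMap_eq_of_signedArea_eq_zero hab (h a ha b hb c hc)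
    exact ⟨t, by simp [AffineMap.lineMap_apply]⟩

/-- If `m` and `z` lie on the line `a b`, with `m` closer than `z` to the foot of the perpendicular
from `c` and on the same side of it, then `m` is closer to the line `c z` than `c` is to `a b`. -/
lemma height_lt_of_inner_nonneg {a b c m z : ℝ × ℝ} {s r : ℝ} (h : signedArea a b c ≠ 0)
    (hm : AffineMap.lineMap a b s = m) (hz : AffineMap.lineMap a b r = z) (hsr : s ≠ r)
    (hin : 0 ≤ (m.1 - c.1) * (z.1 - m.1) + (m.2 - c.2) * (z.2 - m.2)) :
    signedArea c z m ≠ 0 ∧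
      signedArea c z m ^ 2 / sqDist c z < signedArea a b c ^ 2 / sqDist a b := by
  have hab := sqDist_pos (ne_of_signedArea_ne_zero h)
  have hk : r - s ≠ 0 := sub_ne_zero.mpr hsr.symm
  have harea : signedArea c z m = -(r - s) * signedArea a b c := by
    subst hm hz
    simp [signedArea, AffineMap.lineMap_apply]
    ring
  have hdist : sqDist m z = (r - s) ^ 2 * sqDist a b := by
    subst hm hz
    simp [sqDist, AffineMap.lineMap_apply]
    ring
  have hne : signedArea c z m ≠ 0 := by
    rw [harea]
    exact mul_ne_zero (neg_ne_zero.mpr hk) h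
  have hcm : c ≠ m := by
    rintro rfl
    exact hne (by simp [signedArea])
  have hlt : sqDist m z < sqDist c z := by
    have hpos := sqDist_pos hcm
    unfold sqDist at *
    nlinarith
  refine ⟨hne, ?_⟩
  rw [div_lt_div_iff₀ (sqDist_pos (ne_of_signedArea_ne_zero hne)) hab, harea]
  have hsq : 0 < signedArea a b c ^ 2 := by positivity
  calc (-(r - s) * signedArea a b c) ^ 2 * sqDist a b
      = signedArea a b c ^ 2 * sqDist m z := by rw [hdist]; ring
    _ < signedArea a b c ^ 2 * sqDist c z := by gcongr

/-- Given `x`, `m`, `z` on a line with `m` strictly between `x` and `z`, the vector `m - c` makes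
a non-obtuse angle with `x - m` or with `z - m`. -/
lemma inner_nonneg_or_inner_nonneg {a b c m x z : ℝ × ℝ} {s q r : ℝ}
    (hm : AffineMap.lineMap a b s = m) (hx : AffineMap.lineMap a b q = x)
    (hz : AffineMap.lineMap a b r = z) (hqs : q < s) (hsr : s < r) :
    0 ≤ (m.1 - c.1) * (x.1 - m.1) + (m.2 - c.2) * (x.2 - m.2) ∨
      0 ≤ (m.1 - c.1) * (z.1 - m.1) + (m.2 - c.2) * (z.2 - m.2) := by
  have hx' : (m.1 - c.1) * (x.1 - m.1) + (m.2 - c.2) * (x.2 - m.2) =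
      (q - s) * ((m.1 - c.1) * (b.1 - a.1) + (m.2 - c.2) * (b.2 - a.2)) := by
    subst hm hx
    simp [AffineMap.lineMap_apply]
    ring
  have hz' : (m.1 - c.1) * (z.1 - m.1) + (m.2 - c.2) * (z.2 - m.2) =
      (r - s) * ((m.1 - c.1) * (b.1 - a.1) + (m.2 - c.2) * (b.2 - a.2)) := by
    subst hm hz
    simp [AffineMap.lineMap_apply]
    ring
  rw [hx', hz']
  rcases le_total 0 ((m.1 - c.1) * (b.1 - a.1) + (m.2 - c.2) * (b.2 - a.2)) with h | h
  · exact Or.inr (mul_nonneg (by linarith) h)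
  · exact Or.inl (mul_nonneg_of_nonpos_of_nonpos (by linarith) h)

/-- **Sylvester–Gallai theorem.** Every finite non-collinear set of points in the
plane determines a line containing exactly two points of the set. -/
theorem sylvester_gallai
    (P : Finset (ℝ × ℝ)) (hP : ¬ Collinear ℝ (P : Set (ℝ × ℝ))) :
    ∃ L : Set (ℝ × ℝ), IsLine L ∧ (ptsOn P L).card = 2 := by
  obtain ⟨a₀, ha₀, b₀, hb₀, c₀, hc₀, h₀⟩ := exists_signedArea_ne_zero hP
  have hne : ((P ×ˢ P ×ˢ P).filter fun t => signedArea t.1 t.2.1 t.2.2 ≠ 0).Nonempty :=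
    ⟨(a₀, b₀, c₀), by simpa using ⟨⟨ha₀, hb₀, hc₀⟩, h₀⟩⟩
  obtain ⟨⟨a, b, c⟩, habc, hmin⟩ := Finset.exists_min_image _
    (fun t => signedArea t.1 t.2.1 t.2.2 ^ 2 / sqDist t.1 t.2.1) hne
  simp only [Finset.mem_filter, Finset.mem_product] at habc hmin
  obtain ⟨⟨ha, hb, hc⟩, h⟩ := habc
  have hab := ne_of_signedArea_ne_zero h
  have not_lt_lt : ∀ {q s r : ℝ}, AffineMap.lineMap a b q ∈ P → AffineMap.lineMap a b s ∈ P →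
      AffineMap.lineMap a b r ∈ P → q < s → ¬ s < r := by
    intro q s r hq hs hr hqs hsr
    rcases inner_nonneg_or_inner_nonneg (c := c) rfl rfl rfl hqs hsr with hin | hin
    · obtain ⟨hne', hlt⟩ := height_lt_of_inner_nonneg h rfl rfl hqs.ne' hin
      exact (hmin (c, _, _) ⟨⟨hc, hq, hs⟩, hne'⟩).not_gt hlt
    · obtain ⟨hne', hlt⟩ := height_lt_of_inner_nonneg h rfl rfl hsr.ne hin
      exact (hmin (c, _, _) ⟨⟨hc, hr, hs⟩, hne'⟩).not_gt hlt
  refine ⟨_, ⟨a, b, hab, rfl⟩, ?_⟩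
  rw [← Finset.card_pair hab]
  congr 1
  ext d
  simp only [ptsOn, Finset.mem_filter, SetLike.mem_coe, Finset.mem_insert, Finset.mem_singleton]
  constructor
  · rintro ⟨hd, hdL⟩
    obtain ⟨t, rfl⟩ := mem_affineSpan_pair_iff_exists_lineMap_eq.mp hdL
    have ha' : AffineMap.lineMap a b (0 : ℝ) ∈ P := by simpa using ha
    have hb' : AffineMap.lineMap a b (1 : ℝ) ∈ P := by simpa using hb
    rcases lt_trichotomy t 0 with ht | rfl | ht
    · exact (not_lt_lt hd ha' hb' ht one_pos).elim
    · simp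
    rcases lt_trichotomy t 1 with ht1 | rfl | ht1
    · exact (not_lt_lt ha' hd hb' ht ht1).elim
    · simp
    · exact (not_lt_lt ha' hb' hd one_pos ht1).elim
  · rintro (rfl | rfl)
    · exact ⟨ha, left_mem_affineSpan_pair ℝ _ _⟩
    · exact ⟨hb, right_mem_affineSpan_pair ℝ _ _⟩
end
end

section
/- Let R and B be disjoint finite sets of points in the plane such that R ∪ B is not collinear. Then R ∪ B determines a monochromatic line, i.e., a line containing at least two points of R ∪ B all of which belong to R, or all of which belong to B. -/
open scoped Classical

noncomputable section

/-- Three vectors are independent. -/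
def IndepTriple {E : Type*} [AddCommGroup E] [Module ℝ E] (u v w : E) : Prop :=
  ∀ a b c : ℝ, a • u + b • v + c • w = 0 → a = 0 ∧ b = 0 ∧ c = 0

/-- The cone of linear functionals that are nonnegative on `u`, `v` and `w`; projectively, a
triangle in the dual plane with sides `u`, `v` and `w`. -/
def dualCone {E : Type*} [AddCommGroup E] [Module ℝ E] (u v w : E) : Set (Module.Dual ℝ E) :=
  {f | 0 ≤ f u ∧ 0 ≤ f v ∧ 0 ≤ f w}

/-- A triangle with two sides `u`, `v` of colour `c` and third side `w` of the other colour, split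
by a line `a • u - b • v` of the other colour through the common point of `u` and `v`. -/
def IsSplitTriangle {E : Type*} [AddCommGroup E] [Module ℝ E] (T : Bool → Set E)
    (c : Bool) (u v w : E) : Prop :=
  u ∈ T c ∧ v ∈ T c ∧ w ∈ T (!c) ∧ IndepTriple u v w ∧
    ∃ a b : ℝ, 0 < a ∧ 0 < b ∧ a • u - b • v ∈ T (!c)

section VectorSpace

variable {E : Type*} [AddCommGroup E] [Module ℝ E]

theorem IndepTriple.exists_dual {u v w : E} (h : IndepTriple u v w) :
    ∃ f : Module.Dual ℝ E, f u = 0 ∧ f v = 1 ∧ f w = 0 := by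
  have hli : LinearIndependent ℝ ![u, v, w] := by
    rw [Fintype.linearIndependent_iff]
    intro g hg
    simp only [Fin.sum_univ_three, Matrix.cons_val] at hg
    obtain ⟨h0, h1, h2⟩ := h _ _ _ hg
    intro i
    fin_cases i <;> assumption
  obtain ⟨f, hf⟩ := ((Module.Basis.span hli).constr ℝ ![(0 : ℝ), 1, 0]).exists_extend
  have key : ∀ i, f (![u, v, w] i) = ![(0 : ℝ), 1, 0] i := by
    intro i
    have hb := LinearMap.congr_fun hf (Module.Basis.span hli i)
    rwa [Module.Basis.constr_basis, LinearMap.comp_apply, Submodule.subtype_apply,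
      Module.Basis.span_apply] at hb
  exact ⟨f, key 0, key 1, key 2⟩

theorem IndepTriple.swap {u v w : E} (h : IndepTriple u v w) : IndepTriple v u w := by
  intro a b c e
  obtain ⟨h1, h2, h3⟩ := h b a c (by rw [← e]; module)
  exact ⟨h2, h1, h3⟩

theorem IndepTriple.neg_second {u v w : E} (h : IndepTriple u v w) : IndepTriple u (-v) w := by
  intro a b c e
  obtain ⟨h1, h2, h3⟩ := h a (-b) c (by rw [← e]; module)
  exact ⟨h1, by simpa using h2, h3⟩

theorem IndepTriple.split {u v w : E} (h : IndepTriple u v w) {a : ℝ} (ha : a ≠ 0) (b : ℝ) :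
    IndepTriple (a • u - b • v) w v := by
  intro x y z e
  obtain ⟨h1, h2, h3⟩ := h (x * a) (z - x * b) y (by rw [← e]; module)
  have hx : x = 0 := by simpa [ha] using h1
  exact ⟨hx, h3, by simpa [hx] using h2⟩

theorem IndepTriple.pair {u v w : E} (h : IndepTriple u v w) (a b : ℝ)
    (e : a • u + b • v = 0) : a = 0 ∧ b = 0 := by
  obtain ⟨h1, h2, -⟩ := h a b 0 (by rw [← e]; module)
  exact ⟨h1, h2⟩

theorem dualCone_split_ssubset {u v w : E} (h : IndepTriple u v w) {a b : ℝ}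
    (ha : 0 < a) (hb : 0 < b) : dualCone (a • u - b • v) w v ⊂ dualCone u v w := by
  refine ⟨?_, ?_⟩
  · rintro f ⟨h1, h2, h3⟩
    simp only [map_sub, map_smul, smul_eq_mul] at h1
    refine ⟨?_, h3, h2⟩
    have : 0 ≤ a * f u := by nlinarith [mul_nonneg hb.le h3]
    exact nonneg_of_mul_nonneg_right this ha
  · intro hsub
    obtain ⟨f, hu, hv, hw⟩ := h.exists_dual
    have := (hsub (show f ∈ dualCone u v w by simp [dualCone, hu, hv, hw])).1
    simp [hu, hv] at this
    linarith

theorem dualCone_swap (u v w : E) : dualCone u v w = dualCone v u w := by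
  ext f
  simp only [dualCone, Set.mem_ofPred_eq]
  tauto

theorem exists_pos_combination {T : Bool → Set E} (hneg : ∀ c, ∀ u ∈ T c, -u ∈ T c)
    (hT : ∀ c, ∀ u ∈ T c, ∀ v ∈ T c, (∀ a b : ℝ, a • u + b • v = 0 → a = 0 ∧ b = 0) →
      ∃ a b : ℝ, a ≠ 0 ∧ b ≠ 0 ∧ a • u + b • v ∈ T (!c))
    {c : Bool} {u v : E} (hu : u ∈ T c) (hv : v ∈ T c)
    (huv : ∀ a b : ℝ, a • u + b • v = 0 → a = 0 ∧ b = 0) :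
    ∃ a b : ℝ, 0 < a ∧ b ≠ 0 ∧ a • u + b • v ∈ T (!c) := by
  obtain ⟨a, b, ha, hb, hm⟩ := hT c u hu v hv huv
  rcases ha.lt_or_gt with ha | ha
  · refine ⟨-a, -b, by linarith, by simpa using hb, ?_⟩
    convert hneg _ _ hm using 1
    module
  · exact ⟨a, b, ha, hb, hm⟩

theorem IsSplitTriangle.exists_smaller {T : Bool → Set E} (hneg : ∀ c, ∀ u ∈ T c, -u ∈ T c)
    (hT : ∀ c, ∀ u ∈ T c, ∀ v ∈ T c, (∀ a b : ℝ, a • u + b • v = 0 → a = 0 ∧ b = 0) →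
      ∃ a b : ℝ, a ≠ 0 ∧ b ≠ 0 ∧ a • u + b • v ∈ T (!c))
    {c : Bool} {u v w : E} (h : IsSplitTriangle T c u v w) :
    ∃ u' v' w' : E, IsSplitTriangle T (!c) u' v' w' ∧ dualCone u' v' w' ⊂ dualCone u v w := by
  obtain ⟨hu, hv, hw, hi, a, b, ha, hb, hm⟩ := h
  have hi' := hi.split ha.ne' b
  obtain ⟨x, y, hx, hy, hr⟩ := exists_pos_combination hneg hT hm hw hi'.pair
  rcases hy.lt_or_gt with hy | hy
  · refine ⟨a • u - b • v, w, v, ⟨hm, hw, by simpa using hv, hi', x, -y, hx, by linarith, ?_⟩,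
      dualCone_split_ssubset hi ha hb⟩
    convert hr using 1
    module
  · refine ⟨b • v - a • u, w, u, ⟨?_, hw, by simpa using hu, hi.swap.split hb.ne' a,
      x, y, hx, hy, ?_⟩, ?_⟩
    · convert hneg _ _ hm using 1
      module
    · convert hneg _ _ hr using 1
      module
    · rw [dualCone_swap u v w]
      exact dualCone_split_ssubset hi.swap hb ha

theorem not_isSplitTriangle {T : Bool → Set E} (hneg : ∀ c, ∀ u ∈ T c, -u ∈ T c)
    (hT : ∀ c, ∀ u ∈ T c, ∀ v ∈ T c, (∀ a b : ℝ, a • u + b • v = 0 → a = 0 ∧ b = 0) →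
      ∃ a b : ℝ, a ≠ 0 ∧ b ≠ 0 ∧ a • u + b • v ∈ T (!c))
    (hfin : ∀ c, (T c).Finite) (c : Bool) (u v w : E) :
    ¬ IsSplitTriangle T c u v w := by
  intro h
  have hall : (⋃ c, T c).Finite := Set.finite_iUnion hfin
  let K : Set (E × E × E) := {t | ∃ c, IsSplitTriangle T c t.1 t.2.1 t.2.2}
  have hK : K.Finite := by
    refine (hall.prod (hall.prod hall)).subset ?_
    rintro ⟨u, v, w⟩ ⟨c, hu, hv, hw, -⟩
    exact ⟨Set.mem_iUnion_of_mem _ hu, Set.mem_iUnion_of_mem _ hv, Set.mem_iUnion_of_mem _ hw⟩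
  obtain ⟨⟨u, v, w⟩, ⟨c, ht⟩, hmin⟩ := hK.exists_minimalFor
    (fun t => dualCone t.1 t.2.1 t.2.2) K ⟨(u, v, w), c, h⟩
  obtain ⟨u', v', w', ht', hlt⟩ := ht.exists_smaller hneg hT
  exact hlt.2 (hmin (j := (u', v', w')) ⟨_, ht'⟩ hlt.1)

theorem not_indepTriple {T : Bool → Set E} (hneg : ∀ c, ∀ u ∈ T c, -u ∈ T c)
    (hT : ∀ c, ∀ u ∈ T c, ∀ v ∈ T c, (∀ a b : ℝ, a • u + b • v = 0 → a = 0 ∧ b = 0) →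
      ∃ a b : ℝ, a ≠ 0 ∧ b ≠ 0 ∧ a • u + b • v ∈ T (!c))
    (hfin : ∀ c, (T c).Finite) {c : Bool} {u v w : E}
    (hu : u ∈ T c) (hv : v ∈ T c) (hw : w ∈ T (!c)) : ¬ IndepTriple u v w := by
  intro hi
  obtain ⟨a, b, ha, hb, hm⟩ := exists_pos_combination hneg hT hu hv hi.pair
  rcases hb.lt_or_gt with hb | hb
  · refine not_isSplitTriangle hneg hT hfin c u v w
      ⟨hu, hv, hw, hi, a, -b, ha, by linarith, ?_⟩
    convert hm using 1
    module
  · refine not_isSplitTriangle hneg hT hfin c u (-v) w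
      ⟨hu, hneg _ _ hv, hw, hi.neg_second, a, b, ha, hb, ?_⟩
    convert hm using 1
    module

theorem indepTriple_lift {p q r : E} (hpq : p ≠ q) (hr : ∀ t : ℝ, r ≠ AffineMap.lineMap p q t) :
    IndepTriple ((1 : ℝ), p) ((1 : ℝ), q) ((1 : ℝ), r) := by
  intro a b c e
  simp only [Prod.smul_mk, Prod.mk_add_mk, Prod.mk_eq_zero, smul_eq_mul, mul_one] at e
  obtain ⟨e1, e2⟩ := e
  have hc : c = 0 := by
    by_contra hc
    refine hr (-b / c) (smul_right_injective E hc ?_)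
    have ha : a = -b - c := by linarith
    subst ha
    simp only [AffineMap.lineMap_apply_module, smul_add, smul_smul]
    rw [show c * (1 - -b / c) = c + b by field_simp; ring, show c * (-b / c) = -b by field_simp]
    rw [← sub_eq_zero, ← e2]
    module
  subst hc
  have hb : b = -a := by linarith
  subst hb
  have : a • (p - q) = 0 := by rw [← e2]; module
  rcases smul_eq_zero.1 this with h | h
  · simp [h]
  · exact absurd (sub_eq_zero.1 h) hpq

end VectorSpace

section Colouring

variable {E : Type*} [AddCommGroup E] [Module ℝ E] {C : Bool → Finset E}

theorem mem_lineMap_of_bichromatic (hdisj : ∀ c, Disjoint (C c) (C (!c)))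
    (hC : ∀ c, ∀ p ∈ C c, ∀ q ∈ C c, p ≠ q →
      ∃ r ∈ C (!c), ∃ t : ℝ, r = AffineMap.lineMap p q t)
    {c : Bool} {p q r : E} (hp : p ∈ C c) (hq : q ∈ C c) (hr : r ∈ C (!c)) (hpq : p ≠ q) :
    ∃ t : ℝ, r = AffineMap.lineMap p q t := by
  by_contra! hrt
  let T : Bool → Set (ℝ × E) := fun c =>
    (fun p => ((1 : ℝ), p)) '' (C c : Set E) ∪ (fun p => -((1 : ℝ), p)) '' (C c : Set E)
  have hmem : ∀ {c p}, p ∈ C c → ((1 : ℝ), p) ∈ T c := fun h => Or.inl ⟨_, h, rfl⟩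
  have hneg : ∀ c, ∀ u ∈ T c, -u ∈ T c := by
    rintro c u (⟨p, hp, rfl⟩ | ⟨p, hp, rfl⟩)
    · exact Or.inr ⟨p, hp, rfl⟩
    · exact Or.inl ⟨p, hp, by simp⟩
  have hsign : ∀ c, ∀ u ∈ T c, ∃ p ∈ C c, ∃ s : ℝ, s * s = 1 ∧ u = s • ((1 : ℝ), p) := by
    rintro c u (⟨p, hp, rfl⟩ | ⟨p, hp, rfl⟩)
    · exact ⟨p, hp, 1, by simp, by simp⟩
    · exact ⟨p, hp, -1, by simp, by simp⟩
  have hfin : ∀ c, (T c).Finite := fun c =>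
    ((C c).finite_toSet.image _).union ((C c).finite_toSet.image _)
  refine not_indepTriple hneg ?_ hfin (hmem hp) (hmem hq) (hmem hr) (indepTriple_lift hpq hrt)
  intro c u hu v hv huv
  obtain ⟨p, hp, s, hs, rfl⟩ := hsign c u hu
  obtain ⟨q, hq, s', hs', rfl⟩ := hsign c v hv
  have hpq : p ≠ q := by
    rintro rfl
    have := (huv s (-s') (by simp only [smul_smul, hs, neg_mul, hs']; module)).1
    simp [this] at hs
  obtain ⟨r, hr, t, rfl⟩ := hC c p hp q hq hpq
  have hs0 : s ≠ 0 := by rintro rfl; simp at hs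
  have hs0' : s' ≠ 0 := by rintro rfl; simp at hs'
  refine ⟨(1 - t) * s, t * s', mul_ne_zero ?_ hs0, mul_ne_zero ?_ hs0', ?_⟩
  · intro h
    obtain rfl : t = 1 := by linarith
    rw [AffineMap.lineMap_apply_one] at hr
    exact Finset.disjoint_left.1 (hdisj c) hq hr
  · rintro rfl
    rw [AffineMap.lineMap_apply_zero] at hr
    exact Finset.disjoint_left.1 (hdisj c) hp hr
  · convert hmem hr using 1
    rw [smul_smul, smul_smul, mul_assoc, mul_assoc, hs, hs', AffineMap.lineMap_apply_module]
    simp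

/-- A finite two-coloured set without monochromatic lines is collinear. -/
theorem collinear_of_bichromatic (hdisj : ∀ c, Disjoint (C c) (C (!c)))
    (hC : ∀ c, ∀ p ∈ C c, ∀ q ∈ C c, p ≠ q →
      ∃ r ∈ C (!c), ∃ t : ℝ, r = AffineMap.lineMap p q t) :
    Collinear ℝ (⋃ c, (C c : Set E)) := by
  by_cases h : ∃ c, ∃ p ∈ C c, ∃ q ∈ C c, p ≠ q
  · obtain ⟨c, p, hp, q, hq, hpq⟩ := h
    have key : ∀ r ∈ ⋃ c, (C c : Set E), ∃ t : ℝ, r = AffineMap.lineMap p q t := by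
      intro r hr
      obtain ⟨d, hd⟩ := Set.mem_iUnion.1 hr
      rcases Bool.eq_or_eq_not d c with rfl | rfl
      · by_cases hpr : p = r
        · exact ⟨0, by simp [hpr]⟩
        obtain ⟨b, hb, t, rfl⟩ := hC d p hp r hd hpr
        obtain ⟨s, hs⟩ := mem_lineMap_of_bichromatic hdisj hC hp hq hb hpq
        have ht : t ≠ 0 := by
          rintro rfl
          rw [AffineMap.lineMap_apply_zero] at hb
          exact Finset.disjoint_left.1 (hdisj d) hp hb
        refine ⟨s / t, smul_right_injective E ht ?_⟩
        simp only [AffineMap.lineMap_apply_module] at hs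
        simp only [AffineMap.lineMap_apply_module, smul_add, smul_smul]
        rw [show t * (1 - s / t) = t - s by field_simp, show t * (s / t) = s by field_simp]
        rw [← sub_eq_zero] at hs ⊢
        rw [← hs]
        module
      · exact mem_lineMap_of_bichromatic hdisj hC hp hq hd hpq
    rw [collinear_iff_of_mem (Set.mem_iUnion_of_mem c hp)]
    refine ⟨q - p, fun r hr => ?_⟩
    obtain ⟨t, ht⟩ := key r hr
    exact ⟨t, by rw [ht, AffineMap.lineMap_apply]; rfl⟩
  · push Not at h
    have hsub : ∀ c, ∃ p, (C c : Set E) ⊆ {p} := by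
      intro c
      rcases (C c).eq_empty_or_nonempty with he | ⟨p, hp⟩
      · exact ⟨0, by simp [he]⟩
      · exact ⟨p, fun q hq => h c q hq p hp⟩
    choose p hp using hsub
    refine (collinear_pair ℝ (p true) (p false)).subset (Set.iUnion_subset fun c => ?_)
    refine (hp c).trans ?_
    cases c <;> simp

end Colouring

/-- **Motzkin's theorem.** Every non-collinear set of red and blue points in the
plane determines a monochromatic line: a determined line all of whose points of
`R ∪ B` are red, or all blue. -/
theorem motzkin_monochromatic_line
    (R B : Finset (ℝ × ℝ)) (hRB : Disjoint R B)
    (hcol : ¬ Collinear ℝ ((R ∪ B : Finset (ℝ × ℝ)) : Set (ℝ × ℝ))) :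
    ∃ L : Set (ℝ × ℝ), DeterminedLine (R ∪ B) L ∧
      ((∀ p ∈ R ∪ B, p ∈ L → p ∈ R) ∨ (∀ p ∈ R ∪ B, p ∈ L → p ∈ B)) := by
  by_contra! hno
  refine hcol ?_
  let C : Bool → Finset (ℝ × ℝ) := fun c => cond c R B
  have hU : ((R ∪ B : Finset (ℝ × ℝ)) : Set (ℝ × ℝ)) = ⋃ c, (C c : Set (ℝ × ℝ)) := by
    rw [Finset.coe_union, Set.union_eq_iUnion]
    exact Set.iUnion_congr fun c => by cases c <;> rfl
  rw [hU]
  refine collinear_of_bichromatic (fun c => ?_) fun c p hp q hq hpq => ?_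
  · cases c
    · exact hRB.symm
    · exact hRB
  · have hpU : p ∈ R ∪ B := by
      cases c
      · exact Finset.mem_union_right _ hp
      · exact Finset.mem_union_left _ hp
    have hqU : q ∈ R ∪ B := by
      cases c
      · exact Finset.mem_union_right _ hq
      · exact Finset.mem_union_left _ hq
    obtain ⟨⟨x, hx, hxL, hxR⟩, y, hy, hyL, hyB⟩ := hno (affineSpan ℝ {p, q})
      ⟨⟨p, q, hpq, rfl⟩, Finset.one_lt_card.2 ⟨p,
        Finset.mem_filter.2 ⟨hpU, left_mem_affineSpan_pair ℝ p q⟩, q,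
        Finset.mem_filter.2 ⟨hqU, right_mem_affineSpan_pair ℝ p q⟩, hpq⟩⟩
    obtain ⟨t, ht⟩ := mem_affineSpan_pair_iff_exists_lineMap_eq.1 hxL
    obtain ⟨s, hs⟩ := mem_affineSpan_pair_iff_exists_lineMap_eq.1 hyL
    cases c
    · exact ⟨y, (Finset.mem_union.1 hy).resolve_right hyB, s, hs.symm⟩
    · exact ⟨x, (Finset.mem_union.1 hx).resolve_left hxR, t, ht.symm⟩
end
end

section
/- Let R and B be disjoint finite sets of points in the plane with |R| = n and |B| = n or |B| = n - 1, where n ≥ 1. If neither R nor B is collinear, then the set P = R ∪ B determines at least |P| - 3 bichromatic lines. -/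
open scoped Classical

noncomputable section

section Regions

variable {ι E : Type*} [DecidableEq ι] [AddCommGroup E] [Module ℝ E] (φ : ι → Module.Dual ℝ E)

/-- The sign `1` on `S` and `-1` off `S`. -/
def signOn (S : Finset ι) (p : ι) : ℝ := if p ∈ S then 1 else -1

theorem signOn_mul_self (S : Finset ι) (p : ι) : signOn S p * signOn S p = 1 := by
  unfold signOn; split_ifs <;> norm_num

/-- `x` lies on the side prescribed by `S` of every hyperplane indexed by `A`. -/
def InCone (S A : Finset ι) (x : E) : Prop := ∀ p ∈ A, 0 < signOn S p * φ p x

/-- The sign patterns on `A` realised by points of `V`. -/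
def regions (V : Submodule ℝ E) (A : Finset ι) : Finset (Finset ι) :=
  A.powerset.filter fun S => ∃ x ∈ V, InCone φ S A x

variable {φ}

theorem mem_regions {V : Submodule ℝ E} {A S : Finset ι} :
    S ∈ regions φ V A ↔ S ⊆ A ∧ ∃ x ∈ V, InCone φ S A x := by
  simp [regions]

theorem InCone.congr {S T A : Finset ι} {x : E} (h : InCone φ S A x)
    (hST : ∀ p ∈ A, p ∈ S ↔ p ∈ T) : InCone φ T A x := by
  intro p hp
  have := h p hp
  simp only [signOn, hST p hp] at this ⊢
  exact this

theorem InCone.mono {S A A' : Finset ι} {x : E} (h : InCone φ S A x) (hA : A' ⊆ A) :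
    InCone φ S A' x := fun p hp => h p (hA hp)

theorem InCone.exists_perturb {S A : Finset ι} {x : E} (h : InCone φ S A x) (v : E) :
    ∃ ε : ℝ, 0 < ε ∧ InCone φ S A (x + ε • v) := by
  have key : ∀ p ∈ A, ∀ᶠ ε : ℝ in nhdsWithin 0 (Set.Ioi 0),
      0 < signOn S p * φ p (x + ε • v) := by
    intro p hp
    have hc : Continuous fun ε : ℝ => signOn S p * φ p (x + ε • v) := by
      simp only [map_add, map_smul, smul_eq_mul]
      fun_prop
    have h0 : 0 < signOn S p * φ p (x + (0 : ℝ) • v) := by simpa using h p hp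
    exact nhdsWithin_le_nhds (hc.continuousAt.eventually (lt_mem_nhds h0))
  have hall := (Filter.eventually_all_finset A).2 key
  obtain ⟨ε, hε, hpos⟩ := (hall.and self_mem_nhdsWithin).exists
  exact ⟨ε, hpos, hε⟩

theorem InCone.combo {S A : Finset ι} {x y : E} (hx : InCone φ S A x) (hy : InCone φ S A y)
    {a b : ℝ} (ha : 0 ≤ a) (hb : 0 < b) : InCone φ S A (a • x + b • y) := by
  intro p hp
  have h1 := mul_nonneg ha (hx p hp).le
  have h2 := mul_pos hb (hy p hp)
  simp only [map_add, map_smul, smul_eq_mul]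
  nlinarith

theorem regions_empty (V : Submodule ℝ E) : regions φ V ∅ = {∅} := by
  ext S
  simp only [mem_regions, Finset.subset_empty, Finset.mem_singleton]
  exact ⟨fun h => h.1, fun h => ⟨h, 0, V.zero_mem, fun p hp => by simp at hp⟩⟩

theorem regions_eq_empty {V : Submodule ℝ E} {A : Finset ι} {q : ι} (hq : q ∈ A)
    (h : ∀ x ∈ V, φ q x = 0) : regions φ V A = ∅ := by
  ext S
  simp only [mem_regions, Finset.notMem_empty, iff_false]
  rintro ⟨-, x, hx, hc⟩
  simpa [h x hx] using hc q hq

theorem card_regions_insert {V : Submodule ℝ E} {A : Finset ι} {q : ι} (hq : q ∉ A)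
    {v : E} (hv : v ∈ V) (hqv : φ q v ≠ 0) :
    (regions φ V (insert q A)).card =
      (regions φ V A).card + (regions φ (V ⊓ LinearMap.ker (φ q)) A).card := by
  set pos := A.powerset.filter fun S => ∃ x ∈ V, InCone φ S A x ∧ 0 < φ q x with hpos
  set neg := A.powerset.filter fun S => ∃ x ∈ V, InCone φ S A x ∧ φ q x < 0 with hneg
  have hcongr : ∀ {S : Finset ι} {x}, InCone φ S A x ↔ InCone φ (insert q S) A x := by
    intro S x
    have : ∀ p ∈ A, p ∈ S ↔ p ∈ insert q S := by
      intro p hp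
      have : p ≠ q := fun h => hq (h ▸ hp)
      simp [this]
    exact ⟨fun h => h.congr this, fun h => h.congr fun p hp => (this p hp).symm⟩
  have hsplit : regions φ V (insert q A) = pos.image (insert q) ∪ neg := by
    ext S
    simp only [mem_regions, Finset.mem_union, Finset.mem_image, hpos, hneg, Finset.mem_filter,
      Finset.mem_powerset]
    constructor
    · rintro ⟨hS, x, hx, hc⟩
      have hcA := hc.mono (Finset.subset_insert q A)
      have hcq := hc q (Finset.mem_insert_self q A)
      by_cases hqS : q ∈ S
      · left
        refine ⟨S.erase q, ⟨Finset.subset_insert_iff.1 hS, x, hx, ?_, ?_⟩,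
          Finset.insert_erase hqS⟩
        · rw [hcongr, Finset.insert_erase hqS]; exact hcA
        · simpa [signOn, hqS] using hcq
      · right
        refine ⟨(Finset.subset_insert_iff_of_notMem hqS).1 hS, x, hx, hcA, ?_⟩
        simpa [signOn, hqS] using hcq
    · rintro (⟨T, ⟨hT, x, hx, hc, hcq⟩, rfl⟩ | ⟨hS, x, hx, hc, hcq⟩)
      · refine ⟨Finset.insert_subset_insert q hT, x, hx, ?_⟩
        intro p hp
        rcases Finset.mem_insert.1 hp with rfl | hp
        · simpa [signOn] using hcq
        · exact hcongr.1 hc p hp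
      · refine ⟨hS.trans (Finset.subset_insert q A), x, hx, ?_⟩
        intro p hp
        rcases Finset.mem_insert.1 hp with rfl | hp
        · have : p ∉ S := fun h => hq (hS h)
          simpa [signOn, this] using hcq
        · exact hc p hp
  have hunion : regions φ V A = pos ∪ neg := by
    ext S
    simp only [mem_regions, Finset.mem_union, hpos, hneg, Finset.mem_filter, Finset.mem_powerset]
    constructor
    · rintro ⟨hS, x, hx, hc⟩
      rcases lt_trichotomy (φ q x) 0 with h | h | h
      · exact Or.inr ⟨hS, x, hx, hc, h⟩
      · obtain ⟨ε, hε, hcε⟩ := hc.exists_perturb v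
        have hval : φ q (x + ε • v) = ε * φ q v := by simp [h]
        have hmem : x + ε • v ∈ V := V.add_mem hx (V.smul_mem ε hv)
        rcases lt_or_gt_of_ne hqv with h' | h'
        · exact Or.inr ⟨hS, _, hmem, hcε, by rw [hval]; exact mul_neg_of_pos_of_neg hε h'⟩
        · exact Or.inl ⟨hS, _, hmem, hcε, by rw [hval]; exact mul_pos hε h'⟩
      · exact Or.inl ⟨hS, x, hx, hc, h⟩
    · rintro (⟨hS, x, hx, hc, -⟩ | ⟨hS, x, hx, hc, -⟩) <;> exact ⟨hS, x, hx, hc⟩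
  have hinter : regions φ (V ⊓ LinearMap.ker (φ q)) A = pos ∩ neg := by
    ext S
    simp only [mem_regions, Finset.mem_inter, hpos, hneg, Finset.mem_filter, Finset.mem_powerset,
      Submodule.mem_inf, LinearMap.mem_ker]
    constructor
    · rintro ⟨hS, x, ⟨hx, hx0⟩, hc⟩
      obtain ⟨ε, hε, hcε⟩ := hc.exists_perturb (φ q v • v)
      obtain ⟨δ, hδ, hcδ⟩ := hc.exists_perturb (φ q v • -v)
      have hsq : 0 < φ q v * φ q v := mul_self_pos.2 hqv
      refine ⟨⟨hS, _, V.add_mem hx (V.smul_mem _ (V.smul_mem _ hv)), hcε, ?_⟩,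
        ⟨hS, _, V.add_mem hx (V.smul_mem _ (V.smul_mem _ (V.neg_mem hv))), hcδ, ?_⟩⟩
      · simp only [map_add, map_smul, smul_eq_mul, hx0]; nlinarith [mul_pos hε hsq]
      · simp only [map_add, map_smul, map_neg, smul_eq_mul, hx0]; nlinarith [mul_pos hδ hsq]
    · rintro ⟨⟨hS, x, hx, hcx, hx0⟩, ⟨-, y, hy, hcy, hy0⟩⟩
      refine ⟨hS, (-φ q y) • x + φ q x • y,
        ⟨V.add_mem (V.smul_mem _ hx) (V.smul_mem _ hy), ?_⟩, hcx.combo hcy (by linarith) hx0⟩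
      simp only [map_add, map_smul, smul_eq_mul]; ring
  have hdisj : Disjoint (pos.image (insert q)) neg := by
    rw [Finset.disjoint_left]
    intro S hS hS'
    obtain ⟨T, -, rfl⟩ := Finset.mem_image.1 hS
    exact hq (Finset.mem_powerset.1 (Finset.mem_filter.1 hS').1 (Finset.mem_insert_self q T))
  have hinj : (pos.image (insert q)).card = pos.card := by
    refine Finset.card_image_of_injOn fun S hS T hT hST => ?_
    have hSq : q ∉ S := fun h => hq (Finset.mem_powerset.1 (Finset.mem_filter.1 hS).1 h)
    have hTq : q ∉ T := fun h => hq (Finset.mem_powerset.1 (Finset.mem_filter.1 hT).1 h)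
    rw [← Finset.erase_insert hSq, ← Finset.erase_insert hTq]
    exact congrArg (fun U => Finset.erase U q) hST
  rw [hsplit, Finset.card_union_of_disjoint hdisj, hinj, hunion, hinter,
    Finset.card_union_add_card_inter]

theorem card_regions_span_singleton {A : Finset ι} (hA : A.Nonempty) {w : E}
    (hw : ∀ r ∈ A, φ r w ≠ 0) : (regions φ (ℝ ∙ w) A).card = 2 := by
  have hset : regions φ (ℝ ∙ w) A =
      {A.filter fun r => 0 < φ r w, A.filter fun r => φ r w < 0} := by
    ext S
    simp only [mem_regions, Finset.mem_insert, Finset.mem_singleton,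
      Submodule.mem_span_singleton]
    constructor
    · rintro ⟨hS, x, ⟨t, rfl⟩, hc⟩
      rcases lt_trichotomy t 0 with ht | ht | ht
      · right
        ext r
        simp only [Finset.mem_filter]
        refine ⟨fun hr => ⟨hS hr, ?_⟩, fun ⟨hr, h⟩ => ?_⟩
        · have := hc r (hS hr)
          simp only [signOn, hr, if_true, map_smul, smul_eq_mul] at this
          nlinarith
        · by_contra hrS
          have := hc r hr
          simp only [signOn, hrS, if_false, map_smul, smul_eq_mul] at this
          nlinarith [mul_pos_of_neg_of_neg ht h]
      · obtain ⟨r, hr⟩ := hA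
        simpa [ht] using hc r hr
      · left
        ext r
        simp only [Finset.mem_filter]
        refine ⟨fun hr => ⟨hS hr, ?_⟩, fun ⟨hr, h⟩ => ?_⟩
        · have := hc r (hS hr)
          simp only [signOn, hr, if_true, map_smul, smul_eq_mul] at this
          nlinarith
        · by_contra hrS
          have := hc r hr
          simp only [signOn, hrS, if_false, map_smul, smul_eq_mul] at this
          nlinarith [mul_pos ht h]
    · rintro (rfl | rfl)
      · refine ⟨Finset.filter_subset _ _, w, ⟨1, one_smul _ _⟩, fun r hr => ?_⟩
        rcases lt_or_gt_of_ne (hw r hr) with h | h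
        · simp [signOn, hr, not_lt.2 h.le, h]
        · simp [signOn, hr, h]
      · refine ⟨Finset.filter_subset _ _, -w, ⟨-1, by simp⟩, fun r hr => ?_⟩
        rcases lt_or_gt_of_ne (hw r hr) with h | h
        · simp [signOn, hr, h]
        · simp [signOn, hr, not_lt.2 h.le, h]
  rw [hset]
  refine Finset.card_pair fun h => ?_
  obtain ⟨r, hr⟩ := hA
  have := Finset.ext_iff.1 h r
  simp only [Finset.mem_filter, hr, true_and] at this
  rcases lt_or_gt_of_ne (hw r hr) with h | h
  · exact lt_asymm h (this.2 h)
  · exact lt_asymm h (this.1 h)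

/-- The region `S` has a facet on the hyperplane `p`. -/
def IsFacet (φ : ι → Module.Dual ℝ E) (P S : Finset ι) (p : ι) : Prop :=
  S.erase p ∈ regions φ (LinearMap.ker (φ p)) (P.erase p)

theorem three_le_card_facets (hE : 3 ≤ Module.finrank ℝ E) {P : Finset ι}
    (hind : ∀ p ∈ P, ∀ q ∈ P, p ≠ q → ∃ v, φ p v = 1 ∧ φ q v = 0)
    (hspan : ∀ w, (∀ p ∈ P, φ p w = 0) → w = 0) {S : Finset ι} (hS : S ∈ regions φ ⊤ P) :
    3 ≤ (P.filter fun p => IsFacet φ P S p).card := by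
  obtain ⟨hSP, y, -, hy⟩ := mem_regions.1 hS
  obtain ⟨Q, hQ, hmin⟩ := Finset.exists_min_image
    (P.powerset.filter fun Q => ∀ x, InCone φ S Q x → InCone φ S P x) Finset.card
    ⟨P, Finset.mem_filter.2 ⟨Finset.mem_powerset_self P, fun _ h => h⟩⟩
  obtain ⟨hQP, hQcone⟩ := Finset.mem_filter.1 hQ
  rw [Finset.mem_powerset] at hQP
  have hcard : 3 ≤ Q.card := by
    by_contra hlt
    have hker : LinearMap.ker (LinearMap.pi fun q : Q => φ q) ≠ ⊥ := by
      have : Module.Finite ℝ E := Module.finite_of_finrank_pos (by omega)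
      apply LinearMap.ker_ne_bot_of_finrank_lt
      simp only [Module.finrank_fintype_fun_eq_card, Fintype.card_coe]
      omega
    obtain ⟨w, hw, hw0⟩ := Submodule.exists_mem_ne_zero_of_ne_bot hker
    have hwQ : ∀ q ∈ Q, φ q w = 0 := fun q hq => by
      simpa using congrFun (LinearMap.mem_ker.1 hw) ⟨q, hq⟩
    refine hw0 (hspan w fun p hp => ?_)
    by_contra hpw
    have hc : InCone φ S Q (y + (-(φ p y) / φ p w) • w) := fun q hq => by
      simpa [hwQ q hq] using hy q (hQP hq)
    have := hQcone _ hc p hp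
    simp [hpw] at this
  refine hcard.trans (Finset.card_le_card fun q hq => Finset.mem_filter.2 ⟨hQP hq, ?_⟩)
  have hnot : ¬ ∀ x, InCone φ S (Q.erase q) x → InCone φ S P x := fun h => by
    have := hmin (Q.erase q) (Finset.mem_filter.2
      ⟨Finset.mem_powerset.2 ((Finset.erase_subset q Q).trans hQP), h⟩)
    exact absurd (Finset.card_erase_lt_of_mem hq) (not_lt.2 this)
  push Not at hnot
  obtain ⟨x, hx, hxP⟩ := hnot
  have hxq : signOn S q * φ q x ≤ 0 := by
    by_contra h
    refine hxP (hQcone x fun r hr => ?_)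
    by_cases hrq : r = q
    · subst hrq; exact not_le.1 h
    · exact hx r (Finset.mem_erase.2 ⟨hrq, hr⟩)
  have hyq := hy q (hQP hq)
  set z : E := (signOn S q * φ q y) • x + (-(signOn S q * φ q x)) • y with hz
  have hzq : φ q z = 0 := by
    simp only [hz, map_add, map_smul, smul_eq_mul]; ring
  have hzQ : InCone φ S (Q.erase q) z := by
    rw [hz, add_comm]
    exact (hy.mono ((Finset.erase_subset q Q).trans hQP)).combo hx (by linarith) hyq
  refine mem_regions.2 ⟨Finset.erase_subset_erase q hSP, z, hzq, ?_⟩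
  have hzP : InCone φ S (P.erase q) z := by
    intro r hr
    obtain ⟨hrq, hrP⟩ := Finset.mem_erase.1 hr
    by_contra hneg
    obtain ⟨v₁, h₁q, h₁r⟩ := hind q (hQP hq) r hrP (Ne.symm hrq)
    obtain ⟨v₂, h₂r, h₂q⟩ := hind r hrP q (hQP hq) hrq
    obtain ⟨ε, hε, hc⟩ := hzQ.exists_perturb (signOn S q • v₁ - signOn S r • v₂)
    have hcQ : InCone φ S Q (z + ε • (signOn S q • v₁ - signOn S r • v₂)) := by
      intro t ht
      by_cases htq : t = q
      · subst htq
        simp only [map_add, map_sub, map_smul, smul_eq_mul, hzq, h₁q, h₂q]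
        nlinarith [signOn_mul_self S t]
      · exact hc t (Finset.mem_erase.2 ⟨htq, ht⟩)
    have := hQcone _ hcQ r hrP
    simp only [map_add, map_sub, map_smul, smul_eq_mul, h₁r, h₂r] at this
    nlinarith [signOn_mul_self S r]
  refine hzP.congr fun p hp => ?_
  simp [(Finset.mem_erase.1 hp).1]

theorem three_mul_card_regions_le (hE : 3 ≤ Module.finrank ℝ E) {P : Finset ι}
    (hind : ∀ p ∈ P, ∀ q ∈ P, p ≠ q → ∃ v, φ p v = 1 ∧ φ q v = 0)
    (hspan : ∀ w, (∀ p ∈ P, φ p w = 0) → w = 0) :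
    3 * (regions φ ⊤ P).card ≤
      2 * ∑ p ∈ P, (regions φ (LinearMap.ker (φ p)) (P.erase p)).card := by
  calc 3 * (regions φ ⊤ P).card
      = ∑ S ∈ regions φ ⊤ P, 3 := by simp [mul_comm]
    _ ≤ ∑ S ∈ regions φ ⊤ P, (P.filter fun p => IsFacet φ P S p).card :=
        Finset.sum_le_sum fun S hS => three_le_card_facets hE hind hspan hS
    _ = ∑ p ∈ P, ((regions φ ⊤ P).filter fun S => IsFacet φ P S p).card :=
        Finset.sum_card_bipartiteAbove_eq_sum_card_bipartiteBelow _
    _ ≤ ∑ p ∈ P, 2 * (regions φ (LinearMap.ker (φ p)) (P.erase p)).card := by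
        refine Finset.sum_le_sum fun p _ => ?_
        refine (Finset.card_le_card (t := (regions φ (LinearMap.ker (φ p)) (P.erase p)) ∪
          (regions φ (LinearMap.ker (φ p)) (P.erase p)).image (insert p)) fun S hS => ?_).trans
          ((Finset.card_union_le _ _).trans ?_)
        · have hf : S.erase p ∈ _ := (Finset.mem_filter.1 hS).2
          by_cases hp : p ∈ S
          · exact Finset.mem_union_right _
              (Finset.mem_image.2 ⟨_, hf, Finset.insert_erase hp⟩)
          · rw [Finset.erase_eq_of_notMem hp] at hf
            exact Finset.mem_union_left _ hf
        · have := Finset.card_image_le (s := regions φ (LinearMap.ker (φ p)) (P.erase p))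
            (f := insert p)
          omega
    _ = _ := by rw [Finset.mul_sum]

end Regions

section Melchior

/-- A family of blocks such that any two points of `P` lie in exactly one block. -/
structure IsLinearSpace {α : Type*} (P : Finset α) (𝓛 : Finset (Finset α)) : Prop where
  subset : ∀ ℓ ∈ 𝓛, ℓ ⊆ P
  two_le : ∀ ℓ ∈ 𝓛, 2 ≤ ℓ.card
  exists_mem : ∀ p ∈ P, ∀ q ∈ P, p ≠ q → ∃ ℓ ∈ 𝓛, p ∈ ℓ ∧ q ∈ ℓ
  unique : ∀ ℓ ∈ 𝓛, ∀ ℓ' ∈ 𝓛, ∀ p q, p ≠ q → p ∈ ℓ → q ∈ ℓ → p ∈ ℓ' → q ∈ ℓ' → ℓ = ℓ'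

/-- The traces on `P` of the lines determined by `P`. -/
def lines (P : Finset (ℝ × ℝ)) : Finset (Finset (ℝ × ℝ)) :=
  P.powerset.filter fun s => ∃ L, DeterminedLine P L ∧ ptsOn P L = s

/-- Evaluation at `p` of the affine function with coefficients `(a, b, c)`. -/
def affineForm (p : ℝ × ℝ) : Module.Dual ℝ (ℝ × ℝ × ℝ) where
  toFun x := x.1 * p.1 + x.2.1 * p.2 + x.2.2
  map_add' x y := by simp; ring
  map_smul' t x := by simp; ring

theorem affineForm_apply (p : ℝ × ℝ) (x : ℝ × ℝ × ℝ) :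
    affineForm p x = x.1 * p.1 + x.2.1 * p.2 + x.2.2 := rfl

/-- The coefficients of an affine function vanishing at `p` and `q`. -/
def lineForm (p q : ℝ × ℝ) : ℝ × ℝ × ℝ :=
  (p.2 - q.2, q.1 - p.1, p.1 * q.2 - p.2 * q.1)

theorem exists_ne_coord {p q : ℝ × ℝ} (h : p ≠ q) : q.1 - p.1 ≠ 0 ∨ q.2 - p.2 ≠ 0 := by
  by_contra! hc
  exact h (Prod.ext (by linarith [hc.1]) (by linarith [hc.2]))

theorem mem_affineSpan_pair_iff {p q : ℝ × ℝ} (h : p ≠ q) (r : ℝ × ℝ) :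
    r ∈ affineSpan ℝ ({p, q} : Set (ℝ × ℝ)) ↔ affineForm r (lineForm p q) = 0 := by
  rw [mem_affineSpan_pair_iff_exists_lineMap_eq]
  simp only [AffineMap.lineMap_apply_module, affineForm_apply, lineForm]
  constructor
  · rintro ⟨t, rfl⟩
    simp
    ring
  · intro hr
    rcases exists_ne_coord h with h1 | h1
    · refine ⟨(r.1 - p.1) / (q.1 - p.1), Prod.ext ?_ ?_⟩
      · simp
        field_simp
        ring
      · simp
        field_simp
        linear_combination -hr
    · refine ⟨(r.2 - p.2) / (q.2 - p.2), Prod.ext ?_ ?_⟩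
      · simp
        field_simp
        linear_combination hr
      · simp
        field_simp
        ring

theorem IsLine.eq_affineSpan {L : Set (ℝ × ℝ)} (hL : IsLine L) {p q : ℝ × ℝ} (hpq : p ≠ q)
    (hp : p ∈ L) (hq : q ∈ L) : L = affineSpan ℝ ({p, q} : Set (ℝ × ℝ)) := by
  obtain ⟨a, b, hab, rfl⟩ := hL
  obtain ⟨s, rfl⟩ := mem_affineSpan_pair_iff_exists_lineMap_eq.1 hp
  obtain ⟨t, rfl⟩ := mem_affineSpan_pair_iff_exists_lineMap_eq.1 hq
  have hst : t - s ≠ 0 := fun h => hpq (by rw [sub_eq_zero.1 h])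
  ext r
  simp only [SetLike.mem_coe]
  rw [mem_affineSpan_pair_iff hab, mem_affineSpan_pair_iff hpq]
  have key : affineForm r (lineForm (AffineMap.lineMap a b s) (AffineMap.lineMap a b t)) =
      (t - s) * affineForm r (lineForm a b) := by
    simp [AffineMap.lineMap_apply_module, affineForm_apply, lineForm]
    ring
  rw [key]
  simp [hst]

theorem mem_lines {P s : Finset (ℝ × ℝ)} :
    s ∈ lines P ↔ ∃ L, DeterminedLine P L ∧ ptsOn P L = s := by
  simp only [lines, Finset.mem_filter, Finset.mem_powerset, and_iff_right_iff_imp]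
  rintro ⟨L, -, rfl⟩
  exact Finset.filter_subset _ _

theorem mem_iff_of_mem_lines {P ℓ : Finset (ℝ × ℝ)} (hℓ : ℓ ∈ lines P) {p q : ℝ × ℝ}
    (hpq : p ≠ q) (hp : p ∈ ℓ) (hq : q ∈ ℓ) (r : ℝ × ℝ) :
    r ∈ ℓ ↔ r ∈ P ∧ affineForm r (lineForm p q) = 0 := by
  obtain ⟨L, hL, rfl⟩ := mem_lines.1 hℓ
  simp only [ptsOn, Finset.mem_filter] at hp hq ⊢
  rw [hL.1.eq_affineSpan hpq hp.2 hq.2, SetLike.mem_coe, mem_affineSpan_pair_iff hpq]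

theorem isLinearSpace_lines (P : Finset (ℝ × ℝ)) : IsLinearSpace P (lines P) where
  subset ℓ hℓ := by
    obtain ⟨L, -, rfl⟩ := mem_lines.1 hℓ
    exact Finset.filter_subset _ _
  two_le ℓ hℓ := by
    obtain ⟨L, hL, rfl⟩ := mem_lines.1 hℓ
    exact hL.2
  exists_mem p hp q hq hpq := by
    have h1 : p ∈ ptsOn P (affineSpan ℝ ({p, q} : Set (ℝ × ℝ))) :=
      Finset.mem_filter.2 ⟨hp, left_mem_affineSpan_pair ℝ p q⟩
    have h2 : q ∈ ptsOn P (affineSpan ℝ ({p, q} : Set (ℝ × ℝ))) :=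
      Finset.mem_filter.2 ⟨hq, right_mem_affineSpan_pair ℝ p q⟩
    exact ⟨_, mem_lines.2 ⟨_, ⟨⟨p, q, hpq, rfl⟩, Finset.one_lt_card.2 ⟨p, h1, q, h2, hpq⟩⟩, rfl⟩,
      h1, h2⟩
  unique ℓ hℓ ℓ' hℓ' p q hpq hp hq hp' hq' := by
    ext r
    rw [mem_iff_of_mem_lines hℓ hpq hp hq, mem_iff_of_mem_lines hℓ' hpq hp' hq']

theorem ker_inf_ker_affineForm {p q : ℝ × ℝ} (hpq : p ≠ q) :
    LinearMap.ker (affineForm p) ⊓ LinearMap.ker (affineForm q) = ℝ ∙ lineForm p q := by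
  ext x
  simp only [Submodule.mem_inf, LinearMap.mem_ker, Submodule.mem_span_singleton, affineForm_apply,
    lineForm]
  constructor
  · rintro ⟨h1, h2⟩
    rcases exists_ne_coord hpq with h | h
    · refine ⟨x.2.1 / (q.1 - p.1), Prod.ext ?_ (Prod.ext ?_ ?_)⟩ <;> simp <;> field_simp
      · linear_combination h1 - h2
      · linear_combination p.1 * h2 - q.1 * h1
    · refine ⟨-x.1 / (q.2 - p.2), Prod.ext ?_ (Prod.ext ?_ ?_)⟩ <;> simp <;> field_simp
      · ring
      · linear_combination h1 - h2
      · linear_combination p.2 * h2 - q.2 * h1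
  · rintro ⟨t, rfl⟩
    constructor <;> simp <;> ring

theorem exists_affineForm_eq_one_eq_zero {p q : ℝ × ℝ} (hpq : p ≠ q) :
    ∃ v, affineForm p v = 1 ∧ affineForm q v = 0 := by
  rcases exists_ne_coord hpq with h | h
  · refine ⟨(-1 / (q.1 - p.1), 0, q.1 / (q.1 - p.1)), ?_, ?_⟩ <;>
      simp only [affineForm_apply] <;> field_simp <;> ring
  · refine ⟨(0, -1 / (q.2 - p.2), q.2 / (q.2 - p.2)), ?_, ?_⟩ <;>
      simp only [affineForm_apply] <;> field_simp <;> ring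

theorem card_regions_ker_affineForm {P A : Finset (ℝ × ℝ)} (hAP : A ⊆ P) {p : ℝ × ℝ}
    (hp : p ∈ P) (hpA : p ∉ A) (hA : A.Nonempty) :
    (regions affineForm (LinearMap.ker (affineForm p)) A).card =
      2 * ((lines P).filter fun ℓ => p ∈ ℓ ∧ (ℓ ∩ A).Nonempty).card := by
  have hls := isLinearSpace_lines P
  induction A using Finset.induction_on with
  | empty => simp at hA
  | insert q A hqA ih =>
    have hqP : q ∈ P := hAP (Finset.mem_insert_self q A)
    have hAP' : A ⊆ P := (Finset.subset_insert q A).trans hAP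
    have hpA' : p ∉ A := fun h => hpA (Finset.mem_insert_of_mem h)
    have hpq : p ≠ q := fun h => hpA (h ▸ Finset.mem_insert_self q A)
    obtain ⟨v, hv1, hv0⟩ := exists_affineForm_eq_one_eq_zero hpq.symm
    obtain ⟨m, hm, hpm, hqm⟩ := hls.exists_mem p hp q hqP hpq
    rw [card_regions_insert hqA (v := v) hv0 (by rw [hv1]; exact one_ne_zero),
      ker_inf_ker_affineForm hpq]
    have hiff : ∀ ℓ ∈ lines P, p ∈ ℓ → ((ℓ ∩ insert q A).Nonempty ↔
        ℓ = m ∨ (ℓ ∩ A).Nonempty) := by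
      intro ℓ hℓ hpℓ
      constructor
      · rintro ⟨r, hr⟩
        obtain ⟨hrℓ, hr⟩ := Finset.mem_inter.1 hr
        rcases Finset.mem_insert.1 hr with rfl | hr
        · exact Or.inl (hls.unique ℓ hℓ m hm p r hpq hpℓ hrℓ hpm hqm)
        · exact Or.inr ⟨r, Finset.mem_inter.2 ⟨hrℓ, hr⟩⟩
      · rintro (rfl | ⟨r, hr⟩)
        · exact ⟨q, by simp [hqm]⟩
        · exact ⟨r, Finset.inter_subset_inter_left (Finset.subset_insert q A) hr⟩
    by_cases hmA : (m ∩ A).Nonempty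
    · obtain ⟨r, hr⟩ := hmA
      obtain ⟨hrm, hrA⟩ := Finset.mem_inter.1 hr
      have h0 := ((mem_iff_of_mem_lines hm hpq hpm hqm r).1 hrm).2
      rw [ih hAP' hpA' ⟨r, hrA⟩, regions_eq_empty hrA, Finset.card_empty, add_zero]
      · congr 2
        refine Finset.filter_congr fun ℓ hℓ => and_congr_right fun hpℓ => ?_
        rw [hiff ℓ hℓ hpℓ]
        exact ⟨Or.inr, fun h => h.elim (fun h => h ▸ ⟨r, hr⟩) id⟩
      · intro x hx
        obtain ⟨t, rfl⟩ := Submodule.mem_span_singleton.1 hx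
        simp [h0]
    · have hset : (lines P).filter (fun ℓ => p ∈ ℓ ∧ (ℓ ∩ insert q A).Nonempty) =
          insert m ((lines P).filter fun ℓ => p ∈ ℓ ∧ (ℓ ∩ A).Nonempty) := by
        ext ℓ
        simp only [Finset.mem_insert, Finset.mem_filter]
        constructor
        · rintro ⟨hℓ, hpℓ, h⟩
          exact ((hiff ℓ hℓ hpℓ).1 h).imp id fun h => ⟨hℓ, hpℓ, h⟩
        · rintro (rfl | ⟨hℓ, hpℓ, h⟩)
          · exact ⟨hm, hpm, (hiff _ hm hpm).2 (Or.inl rfl)⟩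
          · exact ⟨hℓ, hpℓ, (hiff _ hℓ hpℓ).2 (Or.inr h)⟩
      rw [hset, Finset.card_insert_of_notMem (by simp [hmA])]
      rcases A.eq_empty_or_nonempty with rfl | hA'
      · simp [regions_empty]
      · rw [ih hAP' hpA' hA', card_regions_span_singleton hA']
        · ring
        · intro r hr h0
          exact hmA ⟨r, Finset.mem_inter.2
            ⟨(mem_iff_of_mem_lines hm hpq hpm hqm r).2 ⟨hAP' hr, h0⟩, hr⟩⟩

theorem card_regions_affineForm {P A : Finset (ℝ × ℝ)} (hAP : A ⊆ P) (hA : A.Nonempty) :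
    (regions affineForm ⊤ A).card = 2 + 2 * ∑ ℓ ∈ lines P, ((ℓ ∩ A).card - 1) := by
  induction A using Finset.induction_on with
  | empty => simp at hA
  | insert p A hpA ih =>
    have hp : p ∈ P := hAP (Finset.mem_insert_self p A)
    have hAP' : A ⊆ P := (Finset.subset_insert p A).trans hAP
    rw [card_regions_insert (φ := affineForm) hpA (v := ((0, 0, 1) : ℝ × ℝ × ℝ)) Submodule.mem_top
      (by simp [affineForm_apply]), top_inf_eq]
    have hstep : ∀ ℓ ∈ lines P, (ℓ ∩ insert p A).card - 1 =
        ((ℓ ∩ A).card - 1) + if p ∈ ℓ ∧ (ℓ ∩ A).Nonempty then 1 else 0 := by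
      intro ℓ _
      by_cases hpℓ : p ∈ ℓ
      · rw [Finset.inter_insert_of_mem hpℓ, Finset.card_insert_of_notMem (by simp [hpA])]
        rcases (ℓ ∩ A).eq_empty_or_nonempty with h | h
        · simp [h]
        · have := h.card_pos
          simp only [hpℓ, h, and_self, if_true]
          omega
      · rw [Finset.inter_insert_of_notMem hpℓ]
        simp [hpℓ]
    rw [Finset.sum_congr rfl hstep, Finset.sum_add_distrib, ← Finset.card_filter]
    rcases A.eq_empty_or_nonempty with rfl | hA'
    · simp [regions_empty]
    · rw [ih hAP' hA', card_regions_ker_affineForm hAP' hp hpA hA']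
      ring

theorem collinear_of_affineForm_eq_zero {P : Finset (ℝ × ℝ)} {w : ℝ × ℝ × ℝ} (hw : w ≠ 0)
    (h : ∀ p ∈ P, affineForm p w = 0) : Collinear ℝ (P : Set (ℝ × ℝ)) := by
  rcases P.eq_empty_or_nonempty with rfl | ⟨p, hp⟩
  · simpa using collinear_empty ℝ (ℝ × ℝ)
  refine (collinear_iff_of_mem (Finset.mem_coe.2 hp)).2 ⟨(-w.2.1, w.1), fun r hr => ?_⟩
  have h1 := h p hp
  have h2 := h r hr
  rw [affineForm_apply] at h1 h2
  by_cases ha : w.1 = 0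
  · by_cases hb : w.2.1 = 0
    · refine absurd (Prod.ext ha (Prod.ext hb ?_)) hw
      simpa [ha, hb] using h1
    · refine ⟨-(r.1 - p.1) / w.2.1, Prod.ext ?_ ?_⟩
      · simp
        field_simp
        ring
      · simp
        field_simp
        linear_combination h2 - h1
  · refine ⟨(r.2 - p.2) / w.1, Prod.ext ?_ ?_⟩
    · simp
      field_simp
      linear_combination h2 - h1
    · simp
      field_simp
      ring

/-- **Melchior's inequality.** -/
theorem sum_card_lines_add_three_le {P : Finset (ℝ × ℝ)}
    (hP : ¬ Collinear ℝ (P : Set (ℝ × ℝ))) :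
    ∑ ℓ ∈ lines P, ℓ.card + 3 ≤ 3 * (lines P).card := by
  have hls := isLinearSpace_lines P
  have hne : P.Nonempty := by
    rw [Finset.nonempty_iff_ne_empty]
    rintro rfl
    exact hP (by simpa using collinear_empty ℝ (ℝ × ℝ))
  have hmain := three_mul_card_regions_le (φ := affineForm) (P := P) (by simp)
    (fun p _ q _ hpq => exists_affineForm_eq_one_eq_zero hpq)
    (fun w hw => by_contra fun hw0 => hP (collinear_of_affineForm_eq_zero hw0 hw))
  have hE : ∀ p ∈ P, (regions affineForm (LinearMap.ker (affineForm p)) (P.erase p)).card =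
      2 * ((lines P).filter fun ℓ => p ∈ ℓ).card := by
    intro p hp
    have hne' : (P.erase p).Nonempty := by
      rw [Finset.nonempty_iff_ne_empty]
      intro h
      have hsub : P = {p} := by rw [← Finset.insert_erase hp, h]; rfl
      exact hP (by rw [hsub]; simpa using collinear_singleton ℝ p)
    rw [card_regions_ker_affineForm (Finset.erase_subset p P) hp (Finset.notMem_erase p P) hne']
    congr 2
    refine Finset.filter_congr fun ℓ hℓ => and_iff_left_of_imp fun hpℓ => ?_
    obtain ⟨q, hq, hqp⟩ := Finset.exists_mem_ne (hls.two_le ℓ hℓ) p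
    exact ⟨q, by simp [hq, hqp, hls.subset ℓ hℓ hq]⟩
  rw [card_regions_affineForm subset_rfl hne, Finset.sum_congr rfl hE, ← Finset.mul_sum] at hmain
  have hdc : ∑ p ∈ P, ((lines P).filter fun ℓ => p ∈ ℓ).card = ∑ ℓ ∈ lines P, ℓ.card := by
    refine (Finset.sum_card_bipartiteAbove_eq_sum_card_bipartiteBelow _).trans
      (Finset.sum_congr rfl fun ℓ hℓ => congrArg Finset.card ?_)
    ext q
    simpa [Finset.bipartiteBelow] using fun h => hls.subset ℓ hℓ h
  have hsum : ∑ ℓ ∈ lines P, ((ℓ ∩ P).card - 1) + (lines P).card = ∑ ℓ ∈ lines P, ℓ.card := by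
    rw [Finset.card_eq_sum_ones, ← Finset.sum_add_distrib]
    refine Finset.sum_congr rfl fun ℓ hℓ => ?_
    rw [Finset.inter_eq_left.2 (hls.subset ℓ hℓ)]
    have := hls.two_le ℓ hℓ
    omega
  omega

end Melchior
section Counting

variable {α : Type*} [DecidableEq α] {P R B C : Finset α} {𝓛 : Finset (Finset α)}

namespace IsLinearSpace

theorem sum_card_filter_pairs (h : IsLinearSpace P 𝓛) {X : Finset (α × α)}
    (hX : ∀ x ∈ X, x.1 ∈ P ∧ x.2 ∈ P ∧ x.1 ≠ x.2) :
    ∑ ℓ ∈ 𝓛, (X.filter fun x => x.1 ∈ ℓ ∧ x.2 ∈ ℓ).card = X.card := by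
  simp_rw [Finset.card_filter]
  rw [Finset.sum_comm, Finset.card_eq_sum_ones]
  refine Finset.sum_congr rfl fun x hx => ?_
  obtain ⟨h1, h2, hne⟩ := hX x hx
  obtain ⟨m, hm, hm1, hm2⟩ := h.exists_mem _ h1 _ h2 hne
  rw [← Finset.card_filter, Finset.card_eq_one]
  refine ⟨m, ?_⟩
  ext ℓ
  simp only [Finset.mem_filter, Finset.mem_singleton]
  constructor
  · rintro ⟨hℓ, hℓ1, hℓ2⟩
    exact h.unique ℓ hℓ m hm _ _ hne hℓ1 hℓ2 hm1 hm2
  · rintro rfl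
    exact ⟨hm, hm1, hm2⟩

theorem sum_card_inter_mul_card_inter (h : IsLinearSpace P 𝓛) (hR : R ⊆ P) (hB : B ⊆ P)
    (hRB : Disjoint R B) :
    ∑ ℓ ∈ 𝓛, ((ℓ ∩ R).card * (ℓ ∩ B).card : ℤ) = R.card * B.card := by
  have hX := h.sum_card_filter_pairs (X := R ×ˢ B) fun x hx => by
    rw [Finset.mem_product] at hx
    exact ⟨hR hx.1, hB hx.2, fun he => Finset.disjoint_left.1 hRB hx.1 (he ▸ hx.2)⟩
  rw [Finset.card_product] at hX
  rw [← Nat.cast_mul, ← hX, Nat.cast_sum]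
  refine Finset.sum_congr rfl fun ℓ _ => ?_
  rw [← Nat.cast_mul, ← Finset.card_product]
  congr 2
  ext x
  simp only [Finset.mem_product, Finset.mem_inter, Finset.mem_filter]
  tauto

theorem sum_card_inter_sq_sub (h : IsLinearSpace P 𝓛) (hR : R ⊆ P) :
    ∑ ℓ ∈ 𝓛, (((ℓ ∩ R).card : ℤ) ^ 2 - (ℓ ∩ R).card) = (R.card : ℤ) ^ 2 - R.card := by
  have hcast : ∀ S : Finset α, (S.offDiag.card : ℤ) = (S.card : ℤ) ^ 2 - S.card := fun S => by
    rw [Finset.offDiag_card, Nat.cast_sub (Nat.le_mul_self _), Nat.cast_mul, sq]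
  have hX := h.sum_card_filter_pairs (X := R.offDiag) fun x hx => by
    rw [Finset.mem_offDiag] at hx
    exact ⟨hR hx.1, hR hx.2.1, hx.2.2⟩
  rw [← hcast, ← hX, Nat.cast_sum]
  refine Finset.sum_congr rfl fun ℓ _ => ?_
  rw [← hcast]
  congr 2
  ext x
  simp only [Finset.mem_offDiag, Finset.mem_inter, Finset.mem_filter]
  tauto

end IsLinearSpace

/-- The blocks through `x`, other than `ℓ`, that meet `C`. -/
def pencil (𝓛 : Finset (Finset α)) (ℓ C : Finset α) (x : α) : Finset (Finset α) :=
  (𝓛.erase ℓ).filter fun ℓ' => x ∈ ℓ' ∧ (ℓ' ∩ C).Nonempty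

/-- The blocks meeting both `R` and `B`. -/
def bichromaticBlocks (𝓛 : Finset (Finset α)) (R B : Finset α) : Finset (Finset α) :=
  𝓛.filter fun ℓ => (ℓ ∩ R).Nonempty ∧ (ℓ ∩ B).Nonempty

namespace IsLinearSpace

theorem card_le_card_pencil_mul_card_pencil (h : IsLinearSpace P 𝓛) {ℓ : Finset α} (hℓ : ℓ ∈ 𝓛)
    (hC : C ⊆ P) {x y : α} (hx : x ∈ ℓ) (hy : y ∈ ℓ) (hxy : x ≠ y) :
    (C \ ℓ).card ≤ (pencil 𝓛 ℓ (C \ ℓ) x).card * (pencil 𝓛 ℓ (C \ ℓ) y).card := by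
  have hex : ∀ z ∈ ℓ, ∀ b ∈ C \ ℓ, ∃ m ∈ pencil 𝓛 ℓ (C \ ℓ) z, b ∈ m := by
    intro z hz b hb
    obtain ⟨hbC, hbℓ⟩ := Finset.mem_sdiff.1 hb
    obtain ⟨m, hm, hzm, hbm⟩ := h.exists_mem z (h.subset ℓ hℓ hz) b (hC hbC)
      fun he => hbℓ (he ▸ hz)
    exact ⟨m, Finset.mem_filter.2 ⟨Finset.mem_erase.2 ⟨fun he => hbℓ (he ▸ hbm), hm⟩, hzm,
      b, Finset.mem_inter.2 ⟨hbm, hb⟩⟩, hbm⟩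
  choose! f hf hbf using hex x hx
  choose! g hg hbg using hex y hy
  rw [← Finset.card_product]
  refine Finset.card_le_card_of_injOn (fun b => (f b, g b))
    (fun b hb => Finset.mem_product.2 ⟨hf b hb, hg b hb⟩) fun b hb c hc hbc => ?_
  obtain ⟨hfe, hge⟩ := Prod.mk.inj hbc
  by_contra hne
  have hfm := Finset.mem_filter.1 (hf b hb)
  have hgm := Finset.mem_filter.1 (hg b hb)
  have hfℓ := Finset.mem_erase.1 hfm.1
  have hgℓ := Finset.mem_erase.1 hgm.1
  have hfg : f b = g b := h.unique _ hfℓ.2 _ hgℓ.2 b c hne (hbf b hb) (hfe ▸ hbf c hc)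
    (hbg b hb) (hge ▸ hbg c hc)
  exact hfℓ.1 (h.unique _ hfℓ.2 ℓ hℓ x y hxy hfm.2.1 (hfg ▸ hgm.2.1) hx hy)

theorem sum_card_pencil_add_one_le (h : IsLinearSpace P 𝓛) (hRB : Disjoint R B)
    {ℓ : Finset α} (hℓ : ℓ ∈ bichromaticBlocks 𝓛 R B) :
    ∑ x ∈ ℓ ∩ R, (pencil 𝓛 ℓ (B \ ℓ) x).card + ∑ x ∈ ℓ ∩ B, (pencil 𝓛 ℓ (R \ ℓ) x).card + 1 ≤
      (bichromaticBlocks 𝓛 R B).card := by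
  obtain ⟨hℓ𝓛, -⟩ := Finset.mem_filter.1 hℓ
  have hdisj : ∀ C D : Finset α, ∀ x ∈ ℓ, ∀ y ∈ ℓ, x ≠ y →
      Disjoint (pencil 𝓛 ℓ C x) (pencil 𝓛 ℓ D y) := by
    intro C D x hx y hy hxy
    rw [Finset.disjoint_left]
    intro m hm hm'
    obtain ⟨hme, hxm, -⟩ := Finset.mem_filter.1 hm
    obtain ⟨-, hym, -⟩ := Finset.mem_filter.1 hm'
    obtain ⟨hmℓ, hm𝓛⟩ := Finset.mem_erase.1 hme
    exact hmℓ (h.unique m hm𝓛 ℓ hℓ𝓛 x y hxy hxm hym hx hy)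
  have hU : ∀ C D : Finset α, ((ℓ ∩ C).biUnion (pencil 𝓛 ℓ (D \ ℓ))).card =
      ∑ x ∈ ℓ ∩ C, (pencil 𝓛 ℓ (D \ ℓ) x).card := fun C D =>
    Finset.card_biUnion fun x hx y hy hxy =>
      hdisj _ _ x (Finset.mem_inter.1 hx).1 y (Finset.mem_inter.1 hy).1 hxy
  have hRU : Disjoint ((ℓ ∩ R).biUnion (pencil 𝓛 ℓ (B \ ℓ)))
      ((ℓ ∩ B).biUnion (pencil 𝓛 ℓ (R \ ℓ))) := by
    simp only [Finset.disjoint_biUnion_left, Finset.disjoint_biUnion_right, Finset.mem_inter]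
    intro x hx y hy
    exact hdisj _ _ y hy.1 x hx.1 fun he => Finset.disjoint_left.1 hRB hy.2 (he ▸ hx.2)
  rw [← hU, ← hU, ← Finset.card_union_of_disjoint hRU, ← Finset.card_erase_add_one hℓ]
  refine Nat.add_le_add_right (Finset.card_le_card fun m hm => ?_) 1
  simp only [Finset.mem_union, Finset.mem_biUnion, pencil, Finset.mem_filter, Finset.mem_inter,
    Finset.mem_erase, Finset.Nonempty, Finset.mem_sdiff, bichromaticBlocks] at hm ⊢
  rcases hm with ⟨x, hx, ⟨hmℓ, hm⟩, hxm, b, hbm, hb, -⟩ | ⟨x, hx, ⟨hmℓ, hm⟩, hxm, b, hbm, hb, -⟩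
  · exact ⟨hmℓ, hm, ⟨x, hxm, hx.2⟩, b, hbm, hb⟩
  · exact ⟨hmℓ, hm, ⟨b, hbm, hb⟩, x, hxm, hx.2⟩

end IsLinearSpace

/-- If the pairwise products of at least two natural numbers are at least `J`, then their sum
is large. -/
theorem le_sum_of_le_mul {X : Finset α} {e : α → ℕ} {J : ℕ} (hX : 2 ≤ X.card)
    (he : ∀ x ∈ X, ∀ y ∈ X, x ≠ y → J ≤ e x * e y) :
    (1 ≤ J → X.card ≤ ∑ x ∈ X, e x) ∧ (2 ≤ J → 2 * X.card ≤ ∑ x ∈ X, e x + 1) ∧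
    (3 ≤ J → 2 * X.card ≤ ∑ x ∈ X, e x) ∧ (5 ≤ J → 3 * X.card ≤ ∑ x ∈ X, e x + 1) := by
  obtain ⟨x, hx, hmin⟩ := X.exists_min_image e (Finset.card_pos.1 (by omega))
  have hle : ∀ t, (∀ y ∈ X, y ≠ x → t ≤ e y) → e x + (X.card - 1) * t ≤ ∑ y ∈ X, e y := by
    intro t ht
    rw [← Finset.add_sum_erase X e hx, ← Finset.card_erase_of_mem hx, ← smul_eq_mul]
    refine Nat.add_le_add_left (Finset.card_nsmul_le_sum _ _ _ fun y hy => ?_) _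
    exact ht y (Finset.mem_of_mem_erase hy) (Finset.ne_of_mem_erase hy)
  have hmul : ∀ y ∈ X, y ≠ x → J ≤ e x * e y := fun y hy hyx => he x hx y hy hyx.symm
  obtain ⟨z, hz, hzx⟩ := Finset.exists_mem_ne hX x
  have hpos : 1 ≤ J → 1 ≤ e x := fun hJ =>
    Nat.pos_of_mul_pos_right (hJ.trans (hmul z hz hzx))
  refine ⟨fun hJ => ?_, fun hJ => ?_, fun hJ => ?_, fun hJ => ?_⟩
  · have := hle 1 fun y hy _ => (hpos hJ).trans (hmin y hy)
    have := hpos hJ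
    omega
  · have := hpos (by omega)
    have := hle 2 fun y hy hyx => by
      have := hmin y hy
      have := hmul y hy hyx
      by_contra!
      have : e y = 1 := by omega
      have : e x = 1 := by omega
      simp_all
      omega
    omega
  · have h1 := hpos (by omega)
    rcases h1.eq_or_lt with h1 | h1
    · have := hle 3 fun y hy hyx => by
        have := hmul y hy hyx
        rw [← h1] at this
        omega
      omega
    · have := hle 2 fun y hy _ => le_trans h1 (hmin y hy)
      omega
  · have h1 := hpos (by omega)
    obtain h1 | h1 | h1 : e x = 1 ∨ e x = 2 ∨ 3 ≤ e x := by omega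
    · have := hle 5 fun y hy hyx => by
        have := hmul y hy hyx
        rw [h1] at this
        omega
      omega
    · have := hle 3 fun y hy hyx => by
        have := hmul y hy hyx
        rw [h1] at this
        omega
      omega
    · have := hle 3 fun y hy _ => le_trans h1 (hmin y hy)
      omega

/-- If there are few bichromatic blocks, then a block with at least two points of each colour is
short. -/
theorem IsLinearSpace.three_mul_card_inter_add_three_le (h : IsLinearSpace (R ∪ B) 𝓛)
    (hRB : Disjoint R B) (hcard : B.card = R.card ∨ B.card + 1 = R.card)
    (hR : ∀ ℓ ∈ 𝓛, ¬ R ⊆ ℓ) (hB : ∀ ℓ ∈ 𝓛, ¬ B ⊆ ℓ)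
    (hfew : (bichromaticBlocks 𝓛 R B).card + 4 ≤ R.card + B.card) {ℓ : Finset α} (hℓ : ℓ ∈ 𝓛)
    (hi : 2 ≤ (ℓ ∩ R).card) (hj : 2 ≤ (ℓ ∩ B).card) :
    3 * ((ℓ ∩ R).card + (ℓ ∩ B).card) + 3 ≤ R.card + B.card := by
  have hsum := h.sum_card_pencil_add_one_le hRB (ℓ := ℓ) (Finset.mem_filter.2
    ⟨hℓ, Finset.card_pos.1 (by omega), Finset.card_pos.1 (by omega)⟩)
  have hr := le_sum_of_le_mul hi fun x hx y hy hxy =>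
    h.card_le_card_pencil_mul_card_pencil hℓ Finset.subset_union_right
      (Finset.mem_inter.1 hx).1 (Finset.mem_inter.1 hy).1 hxy
  have hb := le_sum_of_le_mul hj fun x hx y hy hxy =>
    h.card_le_card_pencil_mul_card_pencil hℓ Finset.subset_union_left
      (Finset.mem_inter.1 hx).1 (Finset.mem_inter.1 hy).1 hxy
  have hi' := Finset.card_sdiff_add_card_inter R ℓ
  have hj' := Finset.card_sdiff_add_card_inter B ℓ
  rw [Finset.inter_comm] at hi' hj'
  have hi0 : 1 ≤ (R \ ℓ).card := Finset.card_pos.2 (Finset.sdiff_nonempty.2 (hR ℓ hℓ))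
  have hj0 : 1 ≤ (B \ ℓ).card := Finset.card_pos.2 (Finset.sdiff_nonempty.2 (hB ℓ hℓ))
  generalize (R \ ℓ).card = i' at *
  generalize (B \ ℓ).card = j' at *
  generalize ∑ x ∈ ℓ ∩ R, (pencil 𝓛 ℓ (B \ ℓ) x).card = s at *
  generalize ∑ x ∈ ℓ ∩ B, (pencil 𝓛 ℓ (R \ ℓ) x).card = t at *
  obtain ⟨hr1, hr2, hr3, hr5⟩ := hr
  obtain ⟨hb1, hb2, hb3, hb5⟩ := hb
  omega

theorem IsLinearSpace.sum_card_inter_sub_two_le (h : IsLinearSpace (R ∪ B) 𝓛)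
    (hRB : Disjoint R B) (hM : ∑ ℓ ∈ 𝓛, ℓ.card + 3 ≤ 3 * 𝓛.card) :
    ∑ ℓ ∈ bichromaticBlocks 𝓛 R B, (((ℓ ∩ R).card : ℤ) + (ℓ ∩ B).card - 2) ≤
      4 * (bichromaticBlocks 𝓛 R B).card - (R.card + B.card) - 6 +
        ((R.card : ℤ) - B.card) ^ 2 := by
  have h1 := h.sum_card_inter_mul_card_inter Finset.subset_union_left Finset.subset_union_right hRB
  have h2 := h.sum_card_inter_sq_sub (R := R) Finset.subset_union_left
  have h3 := h.sum_card_inter_sq_sub (R := B) Finset.subset_union_right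
  have hk : ∀ ℓ ∈ 𝓛, ℓ.card = (ℓ ∩ R).card + (ℓ ∩ B).card := fun ℓ hℓ => by
    rw [← Finset.card_union_of_disjoint (hRB.mono Finset.inter_subset_right
      Finset.inter_subset_right), ← Finset.inter_union_distrib_left,
      Finset.inter_eq_left.2 (h.subset ℓ hℓ)]
  rw [Finset.sum_congr rfl hk] at hM
  zify at hM
  have hle : ∑ ℓ ∈ bichromaticBlocks 𝓛 R B, (((ℓ ∩ R).card : ℤ) + (ℓ ∩ B).card - 2 - 4) ≤
      ∑ ℓ ∈ 𝓛, (2 * (((ℓ ∩ R).card : ℤ) + (ℓ ∩ B).card) - 2 * 3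
        - 2 * ((ℓ ∩ R).card * (ℓ ∩ B).card : ℤ) + (((ℓ ∩ R).card : ℤ) ^ 2 - (ℓ ∩ R).card)
        + (((ℓ ∩ B).card : ℤ) ^ 2 - (ℓ ∩ B).card)) := by
    rw [bichromaticBlocks, Finset.sum_filter]
    refine Finset.sum_le_sum fun ℓ hℓ => ?_
    have h2k := h.two_le ℓ hℓ
    rw [hk ℓ hℓ] at h2k
    split_ifs with hb
    · nlinarith [sq_nonneg (((ℓ ∩ R).card : ℤ) - (ℓ ∩ B).card)]
    · rw [not_and_or, ← Finset.card_pos, ← Finset.card_pos] at hb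
      zify at h2k
      rcases hb with hb | hb
      · have h0 : (ℓ ∩ R).card = 0 := by omega
        rw [h0] at h2k ⊢
        push_cast at h2k ⊢
        nlinarith
      · have h0 : (ℓ ∩ B).card = 0 := by omega
        rw [h0] at h2k ⊢
        push_cast at h2k ⊢
        nlinarith
  simp only [Finset.sum_add_distrib, Finset.sum_sub_distrib, ← Finset.mul_sum,
    Finset.sum_const, nsmul_eq_mul] at hle h1 h2 h3 hM ⊢
  nlinarith

theorem IsLinearSpace.card_add_card_le (h : IsLinearSpace (R ∪ B) 𝓛)
    (hRB : Disjoint R B) (hM : ∑ ℓ ∈ 𝓛, ℓ.card + 3 ≤ 3 * 𝓛.card)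
    (hcard : B.card = R.card ∨ B.card + 1 = R.card)
    (hR : ∀ ℓ ∈ 𝓛, ¬ R ⊆ ℓ) (hB : ∀ ℓ ∈ 𝓛, ¬ B ⊆ ℓ) (hB3 : 3 ≤ B.card) :
    R.card + B.card ≤ (bichromaticBlocks 𝓛 R B).card + 3 := by
  by_contra! hlt
  have hshort := fun ℓ (hℓ : ℓ ∈ 𝓛) => h.three_mul_card_inter_add_three_le hRB hcard hR hB
    (by omega) hℓ
  have hsum := h.sum_card_inter_sub_two_le hRB hM
  have hprod : ∑ ℓ ∈ bichromaticBlocks 𝓛 R B, (((ℓ ∩ R).card : ℤ) * (ℓ ∩ B).card - 1) =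
      R.card * B.card - (bichromaticBlocks 𝓛 R B).card := by
    rw [← h.sum_card_inter_mul_card_inter Finset.subset_union_left Finset.subset_union_right hRB,
      Finset.sum_sub_distrib, Finset.sum_const, nsmul_eq_mul, mul_one, sub_left_inj]
    refine Finset.sum_subset (Finset.filter_subset _ _) fun ℓ hℓ hb => ?_
    by_contra h0
    rw [mul_eq_zero, not_or, Nat.cast_eq_zero, Nat.cast_eq_zero, ← ne_eq, ← ne_eq,
      Finset.card_ne_zero, Finset.card_ne_zero] at h0
    exact hb (Finset.mem_filter.2 ⟨hℓ, h0⟩)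
  have hlines : ∀ ℓ ∈ bichromaticBlocks 𝓛 R B, 1 ≤ (ℓ ∩ R).card ∧ 1 ≤ (ℓ ∩ B).card ∧
      (2 ≤ (ℓ ∩ R).card → 2 ≤ (ℓ ∩ B).card →
        3 * ((ℓ ∩ R).card + (ℓ ∩ B).card) + 3 ≤ R.card + B.card) := by
    intro ℓ hℓ
    obtain ⟨hℓ𝓛, hr, hb⟩ := Finset.mem_filter.1 hℓ
    exact ⟨hr.card_pos, hb.card_pos, hshort ℓ hℓ𝓛⟩
  generalize bichromaticBlocks 𝓛 R B = 𝓑 at *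
  by_cases hN : 9 ≤ R.card + B.card
  · have hle : ∑ ℓ ∈ 𝓑, 12 * (((ℓ ∩ R).card : ℤ) * (ℓ ∩ B).card - 1) ≤
        ∑ ℓ ∈ 𝓑, ((R.card : ℤ) + B.card + 3) * (((ℓ ∩ R).card : ℤ) + (ℓ ∩ B).card - 2) := by
      refine Finset.sum_le_sum fun ℓ hℓ => ?_
      obtain ⟨hr, hb, hs⟩ := hlines ℓ hℓ
      rcases hr.eq_or_lt with hr' | hr'
      · rw [← hr']
        push_cast
        nlinarith
      rcases hb.eq_or_lt with hb' | hb'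
      · rw [← hb']
        push_cast
        nlinarith
      have hs' := hs hr' hb'
      zify at hr' hb' hs'
      nlinarith [sq_nonneg (((ℓ ∩ R).card : ℤ) - (ℓ ∩ B).card), mul_nonneg
        (by linarith : (0 : ℤ) ≤ (ℓ ∩ R).card + (ℓ ∩ B).card - 2)
        (by linarith : (0 : ℤ) ≤ R.card + B.card + 3 - 3 * ((ℓ ∩ R).card + (ℓ ∩ B).card + 2))]
    rw [← Finset.mul_sum, ← Finset.mul_sum, hprod] at hle
    have hle' := hle.trans (mul_le_mul_of_nonneg_left hsum (by positivity))
    zify at hlt hcard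
    rcases hcard with hc | hc
    · rw [hc] at hle' hlt
      nlinarith
    · rw [← hc] at hle' hlt
      nlinarith
  · have hle : ∑ ℓ ∈ 𝓑, (((ℓ ∩ R).card : ℤ) * (ℓ ∩ B).card - 1) ≤
        ∑ ℓ ∈ 𝓑, (((ℓ ∩ R).card : ℤ) + (ℓ ∩ B).card - 2) := by
      refine Finset.sum_le_sum fun ℓ hℓ => ?_
      obtain ⟨hr, hb, hs⟩ := hlines ℓ hℓ
      obtain h1 | h1 : (ℓ ∩ R).card = 1 ∨ (ℓ ∩ B).card = 1 := by omega
      · rw [h1]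
        push_cast
        linarith
      · rw [h1]
        push_cast
        linarith
    rw [hprod] at hle
    replace hle := hle.trans hsum
    generalize R.card = n at *
    generalize B.card = m at *
    have : m ≤ 4 := by omega
    rcases hcard with rfl | rfl <;> interval_cases m <;> norm_num at hle <;> omega

end Counting

theorem three_le_card_of_not_collinear {S : Finset (ℝ × ℝ)}
    (hS : ¬ Collinear ℝ (S : Set (ℝ × ℝ))) : 3 ≤ S.card := by
  by_contra! hlt
  obtain h | h | h : S.card = 0 ∨ S.card = 1 ∨ S.card = 2 := by omega
  · rw [Finset.card_eq_zero.1 h, Finset.coe_empty] at hS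
    exact hS (collinear_empty ℝ _)
  · obtain ⟨p, rfl⟩ := Finset.card_eq_one.1 h
    rw [Finset.coe_singleton] at hS
    exact hS (collinear_singleton ℝ p)
  · obtain ⟨p, q, -, rfl⟩ := Finset.card_eq_two.1 h
    rw [Finset.coe_pair] at hS
    exact hS (collinear_pair ℝ p q)

theorem collinear_of_mem_lines {P ℓ : Finset (ℝ × ℝ)} (hℓ : ℓ ∈ lines P) :
    Collinear ℝ (ℓ : Set (ℝ × ℝ)) := by
  obtain ⟨L, ⟨⟨p, q, -, rfl⟩, -⟩, rfl⟩ := mem_lines.1 hℓ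
  have h : Collinear ℝ (affineSpan ℝ ({p, q} : Set (ℝ × ℝ)) : Set (ℝ × ℝ)) := by
    rw [Collinear, ← AffineSubspace.direction_eq_vectorSpan, direction_affineSpan]
    exact collinear_pair ℝ p q
  exact h.subset fun x hx => (Finset.mem_filter.1 hx).2

theorem card_bichromaticBlocks_lines (R B : Finset (ℝ × ℝ)) :
    (bichromaticBlocks (lines (R ∪ B)) R B).card = nBichromatic R B := by
  rw [nBichromatic, ← Set.ncard_coe_finset]
  symm
  refine Set.ncard_congr (fun L _ => ptsOn (R ∪ B) L) ?_ ?_ ?_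
  · rintro L ⟨hL, ⟨p, hp, hpL⟩, q, hq, hqL⟩
    exact Finset.mem_coe.2 (Finset.mem_filter.2 ⟨mem_lines.2 ⟨L, hL, rfl⟩,
      ⟨p, by simp [ptsOn, hp, hpL]⟩, q, by simp [ptsOn, hq, hqL]⟩)
  · rintro L L' ⟨hL, -⟩ ⟨hL', -⟩ he
    obtain ⟨p, hp, q, hq, hpq⟩ := Finset.one_lt_card.1 hL.2
    have hp' := he ▸ hp
    have hq' := he ▸ hq
    simp only [ptsOn, Finset.mem_filter] at hp hq hp' hq'
    rw [hL.1.eq_affineSpan hpq hp.2 hq.2, hL'.1.eq_affineSpan hpq hp'.2 hq'.2]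
  · intro ℓ hℓ
    obtain ⟨hℓ, ⟨p, hp⟩, q, hq⟩ := Finset.mem_filter.1 (Finset.mem_coe.1 hℓ)
    obtain ⟨L, hL, rfl⟩ := mem_lines.1 hℓ
    simp only [ptsOn, Finset.mem_inter, Finset.mem_filter] at hp hq
    exact ⟨L, ⟨hL, ⟨p, hp.2, hp.1.2⟩, q, hq.2, hq.1.2⟩, rfl⟩

/-- **Kleitman–Pinchasi theorem.** If `|R| = n`, `|B| ∈ {n, n-1}` and neither colour
class is collinear, then `R ∪ B` determines at least `|P| - 3` bichromatic lines. -/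
theorem kleitman_pinchasi_weak
    (n : ℕ) (hn : 1 ≤ n) (R B : Finset (ℝ × ℝ)) (hRB : Disjoint R B)
    (hR : R.card = n) (hB : B.card = n ∨ B.card = n - 1)
    (hRcol : ¬ Collinear ℝ (R : Set (ℝ × ℝ)))
    (hBcol : ¬ Collinear ℝ (B : Set (ℝ × ℝ))) :
    (R ∪ B).card - 3 ≤ nBichromatic R B := by
  have hPcol : ¬ Collinear ℝ ((R ∪ B : Finset (ℝ × ℝ)) : Set (ℝ × ℝ)) := fun h =>
    hRcol (h.subset (Finset.coe_subset.2 Finset.subset_union_left))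
  have hmain := (isLinearSpace_lines (R ∪ B)).card_add_card_le hRB
    (sum_card_lines_add_three_le hPcol) (by omega)
    (fun ℓ hℓ h => hRcol ((collinear_of_mem_lines hℓ).subset (Finset.coe_subset.2 h)))
    (fun ℓ hℓ h => hBcol ((collinear_of_mem_lines hℓ).subset (Finset.coe_subset.2 h)))
    (three_le_card_of_not_collinear hBcol)
  rw [card_bichromaticBlocks_lines] at hmain
  rw [Finset.card_union_of_disjoint hRB]
  omega
end
end

section
/- Let P be a finite non-collinear set of points in the plane, and for each i ≥ 2 let t_i denote the number of lines containing exactly i points of P. Then t₂ ≥ 3 + Σ_{i ≥ 3} (i - 3)·t_i (Melchior's inequality). -/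
open scoped Classical

noncomputable section

namespace LineArrangement

variable {ι : Type*} {s r : ι → ℝ}

/-- The line `y = s i * x + r i` passes through the point `v`. -/
def Inc (s r : ι → ℝ) (i : ι) (v : ℝ × ℝ) : Prop := s i * v.1 + r i = v.2

/-- The point `v` is a vertex of the arrangement lying on the line `i`. -/
def VertexOn (s r : ι → ℝ) (i : ι) (v : ℝ × ℝ) : Prop := Inc s r i v ∧ ∃ j, j ≠ i ∧ Inc s r j v

/-- The lines `u` and `l` meet at `v`, and `l` comes directly below `u` to the right of `v`. -/
def Adj (s r : ι → ℝ) (v : ℝ × ℝ) (u l : ι) : Prop :=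
  Inc s r u v ∧ Inc s r l v ∧ s l < s u ∧ ∀ g, Inc s r g v → s l < s g → s u ≤ s g

/-- The point `w` is a corner on the upper boundary, neither leftmost nor rightmost, of the
projective face starting at `v` between the lines `u` and `l`, and it directly follows `v` on one
of these two lines; in the second case the face passes through infinity. -/
def UpperCorner (s r : ι → ℝ) (v : ℝ × ℝ) (u l : ι) (w : ℝ × ℝ) : Prop :=
  (∃ g, s g * w.1 + r g < w.2) ∧
  ((Inc s r u w ∧ (∀ g, Inc s r g w → s g ≤ s u) ∧ v.1 < w.1 ∧
      ∀ c, VertexOn s r u c → v.1 < c.1 → w.1 ≤ c.1) ∨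
   (Inc s r l w ∧ (∀ g, Inc s r g w → s g ≤ s l) ∧
      ∀ c, VertexOn s r l c → w.1 ≤ c.1 ∧ c.1 ≤ v.1))

/-- Reflection in the horizontal axis. -/
def refl (v : ℝ × ℝ) : ℝ × ℝ := (v.1, -v.2)

@[simp] lemma refl_fst (v : ℝ × ℝ) : (refl v).1 = v.1 := rfl

@[simp] lemma refl_refl (v : ℝ × ℝ) : refl (refl v) = v := by simp [refl]

lemma inc_neg {i : ι} {v : ℝ × ℝ} : Inc (-s) (-r) i v ↔ Inc s r i (refl v) := by
  simp only [Inc, refl, Pi.neg_apply]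
  constructor <;> intro h <;> linarith

lemma vertexOn_neg {i : ι} {v : ℝ × ℝ} : VertexOn (-s) (-r) i v ↔ VertexOn s r i (refl v) := by
  simp only [VertexOn, inc_neg]

lemma neg_injective (hs : Function.Injective s) : Function.Injective (-s) :=
  fun _ _ h => hs (neg_inj.1 h)

lemma Inc.eq {i : ι} {v w : ℝ × ℝ} (hv : Inc s r i v) (hw : Inc s r i w) (h : v.1 = w.1) :
    v = w := by
  unfold Inc at hv hw
  exact Prod.ext h (by rw [← hv, ← hw, h])

lemma exists_meet {i j : ι} (h : s j < s i) :
    ∃ m, Inc s r i m ∧ Inc s r j m := by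
  have : s i - s j ≠ 0 := by linarith
  refine ⟨((r j - r i) / (s i - s j), s i * ((r j - r i) / (s i - s j)) + r i), rfl, ?_⟩
  simp only [Inc]
  field_simp
  ring

lemma lt_iff_of_inc {i j : ι} {m : ℝ × ℝ} (h : s j < s i) (hi : Inc s r i m) (hj : Inc s r j m)
    (x : ℝ) : s j * x + r j < s i * x + r i ↔ m.1 < x := by
  unfold Inc at hi hj
  have e : s i * x + r i - (s j * x + r j) = (s i - s j) * (x - m.1) := by linear_combination hi - hj
  rw [← sub_pos, e, mul_pos_iff_of_pos_left (by linarith), sub_pos]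

lemma gt_iff_of_inc {i j : ι} {m : ℝ × ℝ} (h : s j < s i) (hi : Inc s r i m) (hj : Inc s r j m)
    (x : ℝ) : s i * x + r i < s j * x + r j ↔ x < m.1 := by
  unfold Inc at hi hj
  have e : s j * x + r j - (s i * x + r i) = (s i - s j) * (m.1 - x) := by linear_combination hj - hi
  rw [← sub_pos, e, mul_pos_iff_of_pos_left (by linarith), sub_pos]

lemma ne_of_slope_lt {i j : ι} (h : s i < s j) : i ≠ j := by rintro rfl; exact lt_irrefl _ h

lemma Inc.unique {i j : ι} {v w : ℝ × ℝ} (h : s i < s j) (hiv : Inc s r i v) (hjv : Inc s r j v)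
    (hiw : Inc s r i w) (hjw : Inc s r j w) : v = w := by
  refine hiv.eq hiw ?_
  have h1 := lt_iff_of_inc h hjv hiv w.1
  have h2 := gt_iff_of_inc h hjv hiv w.1
  unfold Inc at hiw hjw
  rw [hiw, hjw] at h1 h2
  simp only [lt_irrefl, false_iff, not_lt] at h1 h2
  exact le_antisymm h2 h1

lemma Adj.upperCorner_next {v : ℝ × ℝ} {u l : ι} (h : Adj s r v u l) {a : ℝ × ℝ}
    (ha : Inc s r u a) (hva : v.1 < a.1)
    (hu : ∀ c, VertexOn s r u c → v.1 < c.1 → a.1 ≤ c.1)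
    (hl : ∀ c, VertexOn s r l c → v.1 < c.1 → a.1 ≤ c.1) : UpperCorner s r v u l a := by
  obtain ⟨huv, hlv, hlu, -⟩ := h
  have hla := (lt_iff_of_inc hlu huv hlv a.1).2 hva
  refine ⟨⟨l, by rw [← ha]; exact hla⟩, Or.inl ⟨ha, fun g hg => ?_, hva, hu⟩⟩
  by_contra! hgu
  obtain ⟨c, hgc, hlc⟩ := exists_meet (r := r) (hlu.trans hgu)
  have h1 : c.1 < a.1 := by
    rw [← lt_iff_of_inc (hlu.trans hgu) hgc hlc, hg, ← ha]
    exact hla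
  have h2 : v.1 < c.1 := by
    rw [← gt_iff_of_inc (hlu.trans hgu) hgc hlc, hlv, ← huv]
    exact (gt_iff_of_inc hgu hg ha _).2 hva
  exact absurd (hl c ⟨hlc, g, (ne_of_slope_lt (hlu.trans hgu)).symm, hgc⟩ h2) (not_le.2 h1)

lemma Adj.upperCorner_wrap (hs : Function.Injective s) {v : ℝ × ℝ} {u l : ι} (h : Adj s r v u l)
    {b : ℝ × ℝ} (hb : Inc s r l b) (hbv : b.1 < v.1)
    (hu : ∀ c, VertexOn s r u c → b.1 ≤ c.1 ∧ c.1 ≤ v.1)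
    (hl : ∀ c, VertexOn s r l c → b.1 ≤ c.1 ∧ c.1 ≤ v.1) : UpperCorner s r v u l b := by
  obtain ⟨huv, hlv, hlu, -⟩ := h
  have hub := (gt_iff_of_inc hlu huv hlv b.1).2 hbv
  refine ⟨⟨u, by rw [← hb]; exact hub⟩, Or.inr ⟨hb, fun g hg => ?_, hl⟩⟩
  by_contra! hgl
  rcases lt_trichotomy (s g) (s u) with hgu | hgu | hgu
  · obtain ⟨c, huc, hgc⟩ := exists_meet (r := r) hgu
    have h1 : v.1 < c.1 := by
      rw [← gt_iff_of_inc hgu huc hgc, huv, ← hlv]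
      exact (lt_iff_of_inc hgl hg hb _).2 hbv
    exact absurd (hu c ⟨huc, g, ne_of_slope_lt hgu, hgc⟩).2 (not_le.2 h1)
  · obtain rfl := hs hgu
    exact hbv.ne (congrArg Prod.fst (Inc.unique hgl hb hg hlv huv))
  · obtain ⟨c, hgc, huc⟩ := exists_meet (r := r) hgu
    have h1 : c.1 < b.1 := by
      rw [← lt_iff_of_inc hgu hgc huc, hg, ← hb]
      exact hub
    exact absurd (hu c ⟨huc, g, (ne_of_slope_lt hgu).symm, hgc⟩).1 (not_le.2 h1)

lemma UpperCorner.unique (hs : Function.Injective s) {v v' w : ℝ × ℝ} {u l u' l' : ι}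
    (h : Adj s r v u l) (h' : Adj s r v' u' l')
    (H : UpperCorner s r v u l w) (H' : UpperCorner s r v' u' l' w) :
    v = v' ∧ u = u' ∧ l = l' := by
  obtain ⟨huv, hlv, hlu, hn⟩ := h
  obtain ⟨huv', hlv', hlu', hn'⟩ := h'
  rcases H.2 with ⟨a1, a2, a3, a4⟩ | ⟨a1, a2, a3⟩ <;>
    rcases H'.2 with ⟨b1, b2, b3, b4⟩ | ⟨b1, b2, b3⟩
  · obtain rfl : u = u' := hs (le_antisymm (b2 _ a1) (a2 _ b1))
    have e : v = v' := by
      refine huv.eq huv' (le_antisymm ?_ ?_)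
      · by_contra! hc
        exact absurd (b4 v ⟨huv, l, ne_of_slope_lt hlu, hlv⟩ hc) (not_le.2 a3)
      · by_contra! hc
        exact absurd (a4 v' ⟨huv', l', ne_of_slope_lt hlu', hlv'⟩ hc) (not_le.2 b3)
    subst e
    refine ⟨rfl, rfl, hs (le_antisymm ?_ ?_)⟩
    · by_contra! hc
      exact absurd (hn' l hlv hc) (not_le.2 hlu)
    · by_contra! hc
      exact absurd (hn l' hlv' hc) (not_le.2 hlu')
  · obtain rfl : u = l' := hs (le_antisymm (b2 _ a1) (a2 _ b1))
    exact absurd (b3 v ⟨huv, l, ne_of_slope_lt hlu, hlv⟩).1 (not_le.2 a3)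
  · obtain rfl : l = u' := hs (le_antisymm (b2 _ a1) (a2 _ b1))
    exact absurd (a3 v' ⟨huv', l', ne_of_slope_lt hlu', hlv'⟩).1 (not_le.2 b3)
  · obtain rfl : l = l' := hs (le_antisymm (b2 _ a1) (a2 _ b1))
    have e : v = v' := hlv.eq hlv' (le_antisymm
      (b3 v ⟨hlv, u, (ne_of_slope_lt hlu).symm, huv⟩).2
      (a3 v' ⟨hlv', u', (ne_of_slope_lt hlu').symm, huv'⟩).2)
    subst e
    exact ⟨rfl, hs (le_antisymm (hn _ huv' hlu') (hn' _ huv hlu)), rfl⟩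

lemma Adj.neg {v : ℝ × ℝ} {u l : ι} (h : Adj s r v u l) : Adj (-s) (-r) (refl v) l u := by
  obtain ⟨huv, hlv, hlu, hn⟩ := h
  refine ⟨by simpa [inc_neg] using hlv, by simpa [inc_neg] using huv, by simpa using hlu, ?_⟩
  intro g hg hgu
  rw [inc_neg, refl_refl] at hg
  simp only [Pi.neg_apply, neg_lt_neg_iff, neg_le_neg_iff] at hgu ⊢
  by_contra! hc
  exact absurd (hn g hg hc) (not_le.2 hgu)

lemma exists_vertexOn_pair (hs : Function.Injective s) {i j : ι} (h : j ≠ i) :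
    ∃ v, Inc s r i v ∧ Inc s r j v := by
  rcases lt_or_gt_of_ne (hs.ne h) with h | h
  · exact exists_meet h
  · obtain ⟨v, h1, h2⟩ := exists_meet (r := r) h
    exact ⟨v, h2, h1⟩

lemma concurrent_of_unique (hs : Function.Injective s) {i : ι} {v : ℝ × ℝ} (hi : Inc s r i v)
    (h : ∀ c, VertexOn s r i c → c.1 = v.1) (j : ι) : Inc s r j v := by
  by_cases hji : j = i
  · exact hji ▸ hi
  · obtain ⟨c, hci, hcj⟩ := exists_vertexOn_pair (r := r) hs hji
    exact (hci.eq hi (h c ⟨hci, j, hji, hcj⟩)) ▸ hcj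

lemma exists_vertexOn (hs : Function.Injective s) (hc : ¬ ∃ v, ∀ i, Inc s r i v) (i : ι) :
    ∃ v, VertexOn s r i v := by
  by_contra! h
  exact hc ⟨(0, s i * 0 + r i), concurrent_of_unique hs rfl fun c hc => absurd hc (h c)⟩

lemma le_of_first {i : ι} (hi : ∀ j, s j ≤ s i) (hs : Function.Injective s) {v : ℝ × ℝ}
    (hv : VertexOn s r i v) (hmin : ∀ c, VertexOn s r i c → v.1 ≤ c.1) (g : ι) :
    v.2 ≤ s g * v.1 + r g := by
  by_cases hgi : g = i
  · rw [hgi, hv.1]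
  have hlt : s g < s i := lt_of_le_of_ne (hi g) (hs.ne hgi)
  obtain ⟨c, hic, hgc⟩ := exists_meet (r := r) hlt
  by_contra! h
  rw [← hv.1, lt_iff_of_inc hlt hic hgc] at h
  exact absurd (hmin c ⟨hic, g, hgi, hgc⟩) (not_le.2 h)

lemma le_of_last {i : ι} (hi : ∀ j, s i ≤ s j) (hs : Function.Injective s) {v : ℝ × ℝ}
    (hv : VertexOn s r i v) (hmax : ∀ c, VertexOn s r i c → c.1 ≤ v.1) (g : ι) :
    v.2 ≤ s g * v.1 + r g := by
  by_cases hgi : g = i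
  · rw [hgi, hv.1]
  have hlt : s i < s g := lt_of_le_of_ne (hi g) fun e => hgi (hs e).symm
  obtain ⟨c, hgc, hic⟩ := exists_meet (r := r) hlt
  by_contra! h
  rw [← hv.1, gt_iff_of_inc hlt hgc hic] at h
  exact absurd (hmax c ⟨hic, g, hgi, hgc⟩) (not_le.2 h)

/-- Side `true` (`false`) of a vertex `w` is free if no line passes strictly below (above) `w`. -/
def FreeSide (s r : ι → ℝ) (q : (ℝ × ℝ) × Bool) : Prop :=
  if q.2 then ∀ g, q.1.2 ≤ s g * q.1.1 + r g else ∀ g, s g * q.1.1 + r g ≤ q.1.2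

/-- The relation between gaps and sides of vertices used for counting. -/
def Corner (s r : ι → ℝ) (x : (_ : ℝ × ℝ) × (ι × ι)) (q : (ℝ × ℝ) × Bool) : Prop :=
  if q.2 then UpperCorner s r x.1 x.2.1 x.2.2 q.1
  else UpperCorner (-s) (-r) (refl x.1) x.2.2 x.2.1 (refl q.1)

lemma Corner.not_freeSide {x : (_ : ℝ × ℝ) × (ι × ι)} {q : (ℝ × ℝ) × Bool}
    (h : Corner s r x q) : ¬ FreeSide s r q := by
  obtain ⟨w, t⟩ := q
  intro hf
  cases t
  · simp only [Corner, FreeSide, Bool.false_eq_true, if_false] at h hf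
    obtain ⟨g, hg⟩ := h.1
    have := hf g
    simp only [refl, Pi.neg_apply] at hg
    linarith
  · simp only [Corner, FreeSide, if_true] at h hf
    obtain ⟨g, hg⟩ := h.1
    exact absurd (hf g) (not_le.2 hg)

lemma Corner.unique (hs : Function.Injective s) {x x' : (_ : ℝ × ℝ) × (ι × ι)}
    {q : (ℝ × ℝ) × Bool} (hx : Adj s r x.1 x.2.1 x.2.2) (hx' : Adj s r x'.1 x'.2.1 x'.2.2)
    (h : Corner s r x q) (h' : Corner s r x' q) : x = x' := by
  obtain ⟨v, u, l⟩ := x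
  obtain ⟨v', u', l'⟩ := x'
  obtain ⟨w, t⟩ := q
  cases t
  · simp only [Corner, Bool.false_eq_true, if_false] at h h'
    obtain ⟨h1, rfl, rfl⟩ := UpperCorner.unique (neg_injective hs) hx.neg hx'.neg h h'
    obtain rfl : v = v' := by simpa using congrArg refl h1
    rfl
  · simp only [Corner, if_true] at h h'
    obtain ⟨rfl, rfl, rfl⟩ := UpperCorner.unique hs hx hx' h h'
    rfl

variable [Fintype ι]

/-- The vertices of the arrangement. -/
def vertices (s r : ι → ℝ) : Finset (ℝ × ℝ) :=
  ((Finset.univ : Finset (ι × ι)).image fun q =>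
    ((r q.2 - r q.1) / (s q.1 - s q.2),
      s q.1 * ((r q.2 - r q.1) / (s q.1 - s q.2)) + r q.1)).filter fun v => ∃ i, VertexOn s r i v

lemma mem_vertices (hs : Function.Injective s) {v : ℝ × ℝ} :
    v ∈ vertices s r ↔ ∃ i, VertexOn s r i v := by
  simp only [vertices, Finset.mem_filter, Finset.mem_image, Finset.mem_univ, true_and,
    and_iff_right_iff_imp]
  rintro ⟨i, hi, j, hji, hj⟩
  have hne : s i - s j ≠ 0 := sub_ne_zero.2 fun h => hji (hs h).symm
  unfold Inc at hi hj
  have e : (r j - r i) / (s i - s j) = v.1 := by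
    rw [div_eq_iff hne]; linear_combination hj - hi
  exact ⟨(i, j), Prod.ext e (by simp only [e, hi])⟩

lemma VertexOn.mem (hs : Function.Injective s) {i : ι} {v : ℝ × ℝ} (h : VertexOn s r i v) :
    v ∈ vertices s r := (mem_vertices hs).2 ⟨i, h⟩

lemma exists_vertexOn_min (hs : Function.Injective s) (i : ι) {p : ℝ × ℝ → Prop}
    (h : ∃ v, VertexOn s r i v ∧ p v) :
    ∃ v, (VertexOn s r i v ∧ p v) ∧ ∀ c, VertexOn s r i c → p c → v.1 ≤ c.1 := by
  obtain ⟨v₀, hv₀, hp⟩ := h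
  obtain ⟨v, hv, hmin⟩ := Finset.exists_min_image
    ((vertices s r).filter fun v => VertexOn s r i v ∧ p v) Prod.fst
    ⟨v₀, Finset.mem_filter.2 ⟨hv₀.mem hs, hv₀, hp⟩⟩
  exact ⟨v, (Finset.mem_filter.1 hv).2,
    fun c hc hpc => hmin c (Finset.mem_filter.2 ⟨hc.mem hs, hc, hpc⟩)⟩

lemma exists_next_or_forall_le (hs : Function.Injective s) (i : ι) (v : ℝ × ℝ) :
    (∃ a, (VertexOn s r i a ∧ v.1 < a.1) ∧ ∀ c, VertexOn s r i c → v.1 < c.1 → a.1 ≤ c.1) ∨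
      ∀ c, VertexOn s r i c → c.1 ≤ v.1 := by
  by_cases h : ∃ a, VertexOn s r i a ∧ v.1 < a.1
  · exact Or.inl (exists_vertexOn_min hs i h)
  · push Not at h
    exact Or.inr h

lemma exists_vertexOn_max (hs : Function.Injective s) (i : ι)
    (h : ∃ v, VertexOn s r i v) :
    ∃ v, VertexOn s r i v ∧ ∀ c, VertexOn s r i c → c.1 ≤ v.1 := by
  obtain ⟨v₀, hv₀⟩ := h
  obtain ⟨v, hv, hmin⟩ := Finset.exists_max_image
    ((vertices s r).filter fun v => VertexOn s r i v) Prod.fst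
    ⟨v₀, Finset.mem_filter.2 ⟨hv₀.mem hs, hv₀⟩⟩
  exact ⟨v, (Finset.mem_filter.1 hv).2,
    fun c hc => hmin c (Finset.mem_filter.2 ⟨hc.mem hs, hc⟩)⟩

lemma Adj.exists_corner (hs : Function.Injective s) (hc : ¬ ∃ v, ∀ i, Inc s r i v)
    {v : ℝ × ℝ} {u l : ι} (h : Adj s r v u l) :
    ∃ w ∈ vertices s r, UpperCorner s r v u l w ∨
      UpperCorner (-s) (-r) (refl v) l u (refl w) := by
  have hvu : VertexOn s r u v := ⟨h.1, l, ne_of_slope_lt h.2.2.1, h.2.1⟩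
  have hvl : VertexOn s r l v := ⟨h.2.1, u, (ne_of_slope_lt h.2.2.1).symm, h.1⟩
  rcases exists_next_or_forall_le (r := r) hs u v with ⟨a, ⟨ha, hva⟩, ha'⟩ | hu <;>
    rcases exists_next_or_forall_le (r := r) hs l v with ⟨b, ⟨hb, hvb⟩, hb'⟩ | hl
  · rcases le_total a.1 b.1 with hab | hab
    · exact ⟨a, ha.mem hs, Or.inl (h.upperCorner_next ha.1 hva ha'
        fun c hc hvc => hab.trans (hb' c hc hvc))⟩
    · refine ⟨b, hb.mem hs, Or.inr (h.neg.upperCorner_next (by simpa [inc_neg] using hb.1) hvb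
        (fun c hc hvc => ?_) fun c hc hvc => ?_)⟩
      · exact hb' (refl c) (vertexOn_neg.1 hc) hvc
      · exact hab.trans (ha' (refl c) (vertexOn_neg.1 hc) hvc)
  · exact ⟨a, ha.mem hs, Or.inl (h.upperCorner_next ha.1 hva ha'
      fun c hc hvc => absurd (hl c hc) (not_le.2 hvc))⟩
  · refine ⟨b, hb.mem hs, Or.inr (h.neg.upperCorner_next (by simpa [inc_neg] using hb.1) hvb
      (fun c hc hvc => ?_) fun c hc hvc => ?_)⟩
    · exact hb' (refl c) (vertexOn_neg.1 hc) hvc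
    · exact absurd (hu (refl c) (vertexOn_neg.1 hc)) (not_le.2 hvc)
  · obtain ⟨a, ⟨ha, -⟩, ha'⟩ := exists_vertexOn_min hs u (p := fun _ => True) ⟨v, hvu, trivial⟩
    obtain ⟨b, ⟨hb, -⟩, hb'⟩ := exists_vertexOn_min hs l (p := fun _ => True) ⟨v, hvl, trivial⟩
    simp only [true_implies] at ha' hb'
    rcases le_total b.1 a.1 with hab | hab
    · have hbv : b.1 < v.1 := by
        by_contra! hle
        exact hc ⟨v, concurrent_of_unique hs h.1 fun c hcu =>
          le_antisymm (hu c hcu) ((hle.trans hab).trans (ha' c hcu))⟩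
      exact ⟨b, hb.mem hs, Or.inl (h.upperCorner_wrap hs hb.1 hbv
        (fun c hcu => ⟨hab.trans (ha' c hcu), hu c hcu⟩) fun c hcl => ⟨hb' c hcl, hl c hcl⟩)⟩
    · have hav : a.1 < v.1 := by
        by_contra! hle
        exact hc ⟨v, concurrent_of_unique hs h.2.1 fun c hcl =>
          le_antisymm (hl c hcl) ((hle.trans hab).trans (hb' c hcl))⟩
      refine ⟨a, ha.mem hs, Or.inr (h.neg.upperCorner_wrap (neg_injective hs)
        (by simpa [inc_neg] using ha.1) hav (fun c hcl => ?_) fun c hcu => ?_)⟩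
      · rw [vertexOn_neg] at hcl
        exact ⟨hab.trans (hb' (refl c) hcl), hl (refl c) hcl⟩
      · rw [vertexOn_neg] at hcu
        exact ⟨ha' (refl c) hcu, hu (refl c) hcu⟩

/-- The lines of the arrangement through `v`. -/
def linesThrough (s r : ι → ℝ) (v : ℝ × ℝ) : Finset ι := Finset.univ.filter fun i => Inc s r i v

/-- The pairs of consecutive lines at the point `v`. -/
def gaps (s r : ι → ℝ) (v : ℝ × ℝ) : Finset (ι × ι) :=
  Finset.univ.filter fun q => Adj s r v q.1 q.2

lemma card_linesThrough_le (v : ℝ × ℝ) (hs : Function.Injective s) :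
    (linesThrough s r v).card ≤ (gaps s r v).card + 1 := by
  rcases (linesThrough s r v).eq_empty_or_nonempty with h | h
  · simp [h]
  obtain ⟨m, hm, hmin⟩ := Finset.exists_min_image _ s h
  rw [← Finset.card_erase_add_one hm]
  refine Nat.add_le_add_right ?_ 1
  refine le_trans (Finset.card_le_card fun u hu => ?_)
    (Finset.card_image_le (s := gaps s r v) (f := Prod.fst))
  obtain ⟨hum, hu⟩ := Finset.mem_erase.1 hu
  have hlt : s m < s u := lt_of_le_of_ne (hmin u hu) fun e => hum (hs e).symm
  obtain ⟨l, hl, hmax⟩ := Finset.exists_max_image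
    ((linesThrough s r v).filter fun l => s l < s u) s ⟨m, Finset.mem_filter.2 ⟨hm, hlt⟩⟩
  simp only [linesThrough, Finset.mem_filter, Finset.mem_univ, true_and] at hl hu hmax
  refine Finset.mem_image.2 ⟨(u, l), Finset.mem_filter.2 ⟨Finset.mem_univ _, hu, hl.1, hl.2, ?_⟩,
    rfl⟩
  intro g hg hlg
  by_contra! hgu
  exact absurd (hmax g ⟨hg, hgu⟩) (not_le.2 hlg)

lemma three_le_card_freeSide (hs : Function.Injective s) (hc : ¬ ∃ v, ∀ i, Inc s r i v) :
    3 ≤ ((vertices s r ×ˢ (Finset.univ : Finset Bool)).filter (FreeSide s r)).card := by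
  have hne : Nonempty ι := by
    by_contra h
    rw [not_nonempty_iff] at h
    exact hc ⟨0, fun i => isEmptyElim i⟩
  obtain ⟨U, hU⟩ := Finite.exists_max s
  obtain ⟨L, hL⟩ := Finite.exists_min s
  have key : ∀ i, ∃ a b, (VertexOn s r i a ∧ ∀ c, VertexOn s r i c → a.1 ≤ c.1) ∧
      (VertexOn s r i b ∧ ∀ c, VertexOn s r i c → c.1 ≤ b.1) := fun i => by
    have he := exists_vertexOn hs hc i
    obtain ⟨a, ⟨ha, -⟩, ha'⟩ := exists_vertexOn_min hs i (p := fun _ => True) (by simpa using he)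
    obtain ⟨b, hb⟩ := exists_vertexOn_max hs i he
    exact ⟨a, b, ⟨ha, fun c hc => ha' c hc trivial⟩, hb⟩
  obtain ⟨a, b, ⟨ha, ha'⟩, hb, hb'⟩ := key U
  obtain ⟨c, d, ⟨hc1, hc'⟩, hd, hd'⟩ := key L
  have hsn := neg_injective hs
  have fa : FreeSide s r (a, true) := by
    simpa [FreeSide] using le_of_first hU hs ha ha'
  have fd : FreeSide s r (d, true) := by
    simpa [FreeSide] using le_of_last hL hs hd hd'
  have fc : FreeSide s r (c, false) := by
    have := le_of_first (s := -s) (r := -r) (i := L) (by simpa using hL) hsn (v := refl c)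
      (by simpa [vertexOn_neg] using hc1) (fun e he => hc' (refl e) (vertexOn_neg.1 he))
    simp only [FreeSide, Bool.false_eq_true, if_false]
    intro g
    have := this g
    simp only [refl, Pi.neg_apply] at this
    linarith
  have fb : FreeSide s r (b, false) := by
    have := le_of_last (s := -s) (r := -r) (i := U) (by simpa using hU) hsn (v := refl b)
      (by simpa [vertexOn_neg] using hb) (fun e he => hb' (refl e) (vertexOn_neg.1 he))
    simp only [FreeSide, Bool.false_eq_true, if_false]
    intro g
    have := this g
    simp only [refl, Pi.neg_apply] at this
    linarith
  have mem : ∀ {v : ℝ × ℝ} {i : ι} {t : Bool}, VertexOn s r i v → FreeSide s r (v, t) →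
      (v, t) ∈ (vertices s r ×ˢ (Finset.univ : Finset Bool)).filter (FreeSide s r) :=
    fun hv hf => Finset.mem_filter.2 ⟨Finset.mem_product.2 ⟨hv.mem hs, Finset.mem_univ _⟩, hf⟩
  refine Finset.two_lt_card.2 ?_
  by_cases had : a = d
  · have hbc : b ≠ c := by
      rintro rfl
      subst had
      refine hc ⟨a, concurrent_of_unique hs ha.1 fun e he => le_antisymm ?_ (ha' e he)⟩
      exact (hb' e he).trans (hd' _ hc1)
    exact ⟨_, mem ha fa, _, mem hc1 fc, _, mem hb fb, by simp, by simp, by simpa using hbc.symm⟩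
  · exact ⟨_, mem ha fa, _, mem hd fd, _, mem hc1 fc, by simpa using had, by simp, by simp⟩

/-- Melchior's inequality for line arrangements. -/
theorem sum_card_linesThrough_le (hs : Function.Injective s) (hc : ¬ ∃ v, ∀ i, Inc s r i v) :
    ∑ v ∈ vertices s r, (linesThrough s r v).card + 3 ≤ 3 * (vertices s r).card := by
  have h1 : ∑ v ∈ vertices s r, (linesThrough s r v).card ≤
      ((vertices s r).sigma (gaps s r)).card + (vertices s r).card := by
    rw [Finset.card_sigma, Finset.card_eq_sum_ones, ← Finset.sum_add_distrib]
    exact Finset.sum_le_sum fun v _ => card_linesThrough_le v hs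
  have h2 : ((vertices s r).sigma (gaps s r)).card ≤
      ((vertices s r ×ˢ (Finset.univ : Finset Bool)).filter fun q => ¬ FreeSide s r q).card := by
    have hadj : ∀ x ∈ (vertices s r).sigma (gaps s r), Adj s r x.1 x.2.1 x.2.2 := fun x hx =>
      (Finset.mem_filter.1 (Finset.mem_sigma.1 hx).2).2
    refine Finset.card_le_card_of_forall_subsingleton (Corner s r) (fun x hx => ?_)
      fun q _ x hx x' hx' => Corner.unique hs (hadj x hx.1) (hadj x' hx'.1) hx.2 hx'.2
    obtain ⟨w, hw, h⟩ := (hadj x hx).exists_corner hs hc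
    obtain ⟨t, ht⟩ : ∃ t, Corner s r x (w, t) := by
      rcases h with h | h
      · exact ⟨true, by simpa [Corner] using h⟩
      · exact ⟨false, by simpa [Corner] using h⟩
    exact ⟨(w, t), Finset.mem_filter.2
      ⟨Finset.mem_product.2 ⟨hw, Finset.mem_univ _⟩, ht.not_freeSide⟩, ht⟩
  have h3 := three_le_card_freeSide hs hc
  have h4 := Finset.card_filter_add_card_filter_not (s := vertices s r ×ˢ (Finset.univ : Finset Bool))
    (FreeSide s r)
  rw [Finset.card_product, Finset.card_univ, Fintype.card_bool] at h4
  omega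

end LineArrangement

namespace LineArrangement

/-- The set of points whose dual lines, after a shear by `ε`, pass through `v`. -/
def dualLine (ε : ℝ) (v : ℝ × ℝ) : Set (ℝ × ℝ) := {p | (p.1 + ε * p.2) * v.1 + p.2 = v.2}

lemma exists_eq_smul_add {ε : ℝ} {v p x : ℝ × ℝ} (hp : p ∈ dualLine ε v) (hx : x ∈ dualLine ε v) :
    ∃ t : ℝ, x = t • ((-(1 + ε * v.1), v.1) : ℝ × ℝ) + p := by
  have hD : 0 < (1 + ε * v.1) ^ 2 + v.1 ^ 2 := by
    by_cases h : v.1 = 0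
    · simp [h]
    · positivity
  simp only [dualLine, Set.mem_ofPred_eq] at hp hx
  refine ⟨(v.1 * (x.2 - p.2) - (1 + ε * v.1) * (x.1 - p.1)) / ((1 + ε * v.1) ^ 2 + v.1 ^ 2),
    Prod.ext ?_ ?_⟩
  · simp only [Prod.fst_add, Prod.smul_fst, smul_eq_mul]
    rw [div_mul_eq_mul_div, ← sub_eq_iff_eq_add, eq_div_iff hD.ne']
    linear_combination v.1 * (hx - hp)
  · simp only [Prod.snd_add, Prod.smul_snd, smul_eq_mul]
    rw [div_mul_eq_mul_div, ← sub_eq_iff_eq_add, eq_div_iff hD.ne']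
    linear_combination (1 + ε * v.1) * (hx - hp)

lemma dualLine_eq_affineSpan {ε : ℝ} {v p q : ℝ × ℝ} (hp : p ∈ dualLine ε v)
    (hq : q ∈ dualLine ε v) (hpq : p ≠ q) :
    dualLine ε v = (affineSpan ℝ ({p, q} : Set (ℝ × ℝ)) : Set (ℝ × ℝ)) := by
  obtain ⟨a, ha⟩ := exists_eq_smul_add hp hq
  have ha0 : a ≠ 0 := by
    rintro rfl
    exact hpq (by simpa using ha.symm)
  ext x
  rw [SetLike.mem_coe, mem_affineSpan_pair_iff_exists_lineMap_eq]
  constructor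
  · intro hx
    obtain ⟨t, ht⟩ := exists_eq_smul_add hp hx
    refine ⟨t / a, ?_⟩
    rw [AffineMap.lineMap_apply, ht, ha, vsub_eq_sub, add_sub_cancel_right, smul_smul,
      div_mul_cancel₀ _ ha0, vadd_eq_add]
  · rintro ⟨t, rfl⟩
    simp only [dualLine, Set.mem_ofPred_eq] at hp hq
    simp only [dualLine, Set.mem_ofPred_eq, AffineMap.lineMap_apply, vsub_eq_sub, vadd_eq_add,
      Prod.fst_add, Prod.snd_add, Prod.smul_fst, Prod.smul_snd, Prod.fst_sub, Prod.snd_sub,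
      smul_eq_mul]
    linear_combination (1 - t) * hp + t * hq

lemma isLine_dualLine {ε : ℝ} {v p q : ℝ × ℝ} (hp : p ∈ dualLine ε v)
    (hq : q ∈ dualLine ε v) (hpq : p ≠ q) : IsLine (dualLine ε v) :=
  ⟨p, q, hpq, dualLine_eq_affineSpan hp hq hpq⟩

lemma collinear_of_subset_dualLine {ε : ℝ} {v : ℝ × ℝ} {A : Set (ℝ × ℝ)}
    (h : A ⊆ dualLine ε v) : Collinear ℝ A := by
  rcases A.eq_empty_or_nonempty with rfl | ⟨p, hp⟩
  · exact collinear_empty ℝ _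
  · exact (collinear_iff_of_mem hp).2 ⟨_, fun x hx => exists_eq_smul_add (h hp) (h hx)⟩

lemma _root_.IsLine.eq_affineSpan_s17 {L : Set (ℝ × ℝ)} (hL : IsLine L) {p q : ℝ × ℝ} (hp : p ∈ L)
    (hq : q ∈ L) (hpq : p ≠ q) : L = (affineSpan ℝ ({p, q} : Set (ℝ × ℝ)) : Set (ℝ × ℝ)) := by
  obtain ⟨a, b, -, rfl⟩ := hL
  rw [affineSpan_pair_eq_of_mem_of_mem_of_ne hp hq hpq]

lemma exists_shear_injOn (P : Finset (ℝ × ℝ)) :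
    ∃ ε : ℝ, Function.Injective fun p : P => p.1.1 + ε * p.1.2 := by
  obtain ⟨ε, hε⟩ := Infinite.exists_notMem_finset
    ((P ×ˢ P).image fun z => -(z.1.1 - z.2.1) / (z.1.2 - z.2.2))
  refine ⟨ε, fun p q h => Subtype.ext ?_⟩
  simp only at h
  by_cases h2 : p.1.2 - q.1.2 = 0
  · have h3 := sub_eq_zero.1 h2
    exact Prod.ext (by rw [h3] at h; linarith) h3
  · refine absurd (Finset.mem_image.2 ⟨(p.1, q.1), Finset.mk_mem_product p.2 q.2, ?_⟩) hε
    rw [div_eq_iff h2]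
    linear_combination -h

/-- The lines determined by `P` correspond to the vertices of the dual arrangement. -/
lemma card_lines_eq {P : Finset (ℝ × ℝ)} {ε : ℝ} {s r : P → ℝ} (hs : Function.Injective s)
    (hs' : s = fun p => p.1.1 + ε * p.1.2) (hr : r = fun p => p.1.2) {i : ℕ} (hi : 2 ≤ i) :
    {L : Set (ℝ × ℝ) | IsLine L ∧ (ptsOn P L).card = i}.ncard =
      ((vertices s r).filter fun v => (linesThrough s r v).card = i).card := by
  have hinc : ∀ p v, Inc s r p v ↔ p.1 ∈ dualLine ε v := by
    simp [Inc, dualLine, hs', hr]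
  have hcard : ∀ v, (linesThrough s r v).card = (ptsOn P (dualLine ε v)).card := by
    intro v
    rw [← Finset.card_map (Function.Embedding.subtype (· ∈ P))]
    congr 1
    ext x
    simp [linesThrough, ptsOn, hinc, and_comm]
  have hver : ∀ v ∈ vertices s r, ∃ p q : P, p ≠ q ∧ Inc s r p v ∧ Inc s r q v := by
    intro v hv
    obtain ⟨p, hp, q, hqp, hq⟩ := (mem_vertices hs).1 hv
    exact ⟨p, q, hqp.symm, hp, hq⟩
  rw [← Set.ncard_coe_finset]
  symm
  refine Set.ncard_congr (fun v _ => dualLine ε v) (fun v hv => ?_) (fun v w hv hw h => ?_)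
    fun L hL => ?_
  · obtain ⟨hv, hvi⟩ := Finset.mem_filter.1 hv
    obtain ⟨p, q, hpq, hp, hq⟩ := hver v hv
    exact ⟨isLine_dualLine ((hinc _ _).1 hp) ((hinc _ _).1 hq) fun e => hpq (Subtype.ext e),
      hcard v ▸ hvi⟩
  · obtain ⟨p, q, hpq, hp, hq⟩ := hver v (Finset.mem_filter.1 hv).1
    have hp' : Inc s r p w := (hinc _ _).2 (h ▸ (hinc _ _).1 hp)
    have hq' : Inc s r q w := (hinc _ _).2 (h ▸ (hinc _ _).1 hq)
    rcases lt_or_gt_of_ne (hs.ne hpq) with hlt | hlt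
    · exact Inc.unique hlt hp hq hp' hq'
    · exact Inc.unique hlt hq hp hq' hp'
  · obtain ⟨hL, hLi⟩ := hL
    obtain ⟨p, hp, q, hq, hpq⟩ := Finset.one_lt_card.1 (by omega : 1 < (ptsOn P L).card)
    obtain ⟨hpP, hpL⟩ := Finset.mem_filter.1 hp
    obtain ⟨hqP, hqL⟩ := Finset.mem_filter.1 hq
    have hne : (⟨q, hqP⟩ : P) ≠ ⟨p, hpP⟩ := fun e => hpq (congrArg Subtype.val e).symm
    obtain ⟨v, hpv, hqv⟩ := exists_vertexOn_pair (r := r) hs hne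
    have e : dualLine ε v = L := by
      rw [dualLine_eq_affineSpan ((hinc _ _).1 hpv) ((hinc _ _).1 hqv) hpq,
        hL.eq_affineSpan_s17 hpL hqL hpq]
    have hv : VertexOn s r ⟨p, hpP⟩ v := ⟨hpv, _, hne, hqv⟩
    exact ⟨v, Finset.mem_filter.2 ⟨hv.mem hs, by rw [hcard, e, hLi]⟩, e⟩

end LineArrangement

/-- **Melchior's inequality.** For a finite non-collinear planar point set `P`,
with `t i` the number of lines containing exactly `i` points of `P`,
`t₂ ≥ 3 + ∑_{i ≥ 3} (i - 3) t_i`.  (Lines with more than `|P|` points do not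
exist, so the sum may be taken over `3 ≤ i ≤ |P|`.) -/
theorem melchior_inequality
    (P : Finset (ℝ × ℝ)) (hP : ¬ Collinear ℝ (P : Set (ℝ × ℝ)))
    (t : ℕ → ℕ)
    (ht : ∀ i, t i = {L : Set (ℝ × ℝ) | IsLine L ∧ (ptsOn P L).card = i}.ncard) :
    3 + ∑ i ∈ Finset.Icc 3 P.card, (i - 3) * t i ≤ t 2 := by
  obtain ⟨ε, hε⟩ := LineArrangement.exists_shear_injOn P
  obtain ⟨s, hs'⟩ : ∃ s : P → ℝ, s = fun p => p.1.1 + ε * p.1.2 := ⟨_, rfl⟩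
  obtain ⟨r, hr⟩ : ∃ r : P → ℝ, r = fun p => p.1.2 := ⟨_, rfl⟩
  have hs : Function.Injective s := hs' ▸ hε
  have hc : ¬ ∃ v, ∀ i, LineArrangement.Inc s r i v := by
    rintro ⟨v, hv⟩
    refine hP (LineArrangement.collinear_of_subset_dualLine (ε := ε) (v := v) fun p hp => ?_)
    simpa [LineArrangement.Inc, LineArrangement.dualLine, hs', hr] using hv ⟨p, hp⟩
  have ht' : ∀ i, 2 ≤ i → t i = ((LineArrangement.vertices s r).filter
      fun v => (LineArrangement.linesThrough s r v).card = i).card := fun i hi => by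
    rw [ht, LineArrangement.card_lines_eq hs hs' hr hi]
  have hmaps : ∀ v ∈ LineArrangement.vertices s r,
      (LineArrangement.linesThrough s r v).card ∈ Finset.Icc 2 P.card := fun v hv => by
    obtain ⟨i, hi, j, hji, hj⟩ := (LineArrangement.mem_vertices hs).1 hv
    refine Finset.mem_Icc.2 ⟨Finset.one_lt_card.2 ⟨i, Finset.mem_filter.2 ⟨Finset.mem_univ _, hi⟩,
      j, Finset.mem_filter.2 ⟨Finset.mem_univ _, hj⟩, hji.symm⟩, ?_⟩
    simpa using Finset.card_le_univ (LineArrangement.linesThrough s r v)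
  have hsum : ∀ f : ℕ → ℕ, ∑ v ∈ LineArrangement.vertices s r,
      f (LineArrangement.linesThrough s r v).card = ∑ i ∈ Finset.Icc 2 P.card, f i * t i := by
    intro f
    rw [← Finset.sum_fiberwise_of_maps_to' hmaps]
    refine Finset.sum_congr rfl fun i hi => ?_
    rw [ht' i (Finset.mem_Icc.1 hi).1, Finset.sum_const, smul_eq_mul, mul_comm]
  have hP2 : 2 ≤ P.card := by
    obtain ⟨i, -⟩ : ∃ i : P, True := by
      by_contra! h
      exact hc ⟨0, fun i => (h i).elim⟩
    obtain ⟨v, hv⟩ := LineArrangement.exists_vertexOn hs hc i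
    have := Finset.mem_Icc.1 (hmaps v (hv.mem hs))
    omega
  have main := LineArrangement.sum_card_linesThrough_le hs hc
  have h1 := hsum id
  have h2 := hsum fun _ => 3
  rw [Finset.sum_const, smul_eq_mul] at h2
  simp only [id] at h1
  rw [← Finset.add_sum_Ioc_eq_sum_Icc hP2] at h1 h2
  have h3 : ∑ i ∈ Finset.Ioc 2 P.card, i * t i =
      ∑ i ∈ Finset.Icc 3 P.card, (i - 3) * t i + ∑ i ∈ Finset.Ioc 2 P.card, 3 * t i := by
    have e : Finset.Icc 3 P.card = Finset.Ioc 2 P.card := by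
      ext i
      simp only [Finset.mem_Icc, Finset.mem_Ioc]
      omega
    rw [e, ← Finset.sum_add_distrib]
    refine Finset.sum_congr rfl fun i hi => ?_
    rw [← add_mul, Nat.sub_add_cancel (Finset.mem_Ioc.1 hi).1]
  omega
end
end
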